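/- In the normalized setting, for every d > 0 such that both A_d^+ and A_d^− are nonempty, there exists a constant C ≥ 1, depending only on N, d and β (in particular, not on γ or u), such that sup_{[0,1]×A_d} u ≤ C · inf_{[0,1]×B_1(0)} u. -/

import Mathlib

open MeasureTheory Set Metric ProbabilityTheory

noncomputable section

/-- `ℝ^{N-1}`, the space of the variable `y`. -/
abbrev Euc (N : ℕ) : Type := EuclideanSpace ℝ (Fin (N - 1))

/-- The partial derivative `∂φ/∂x` of a function on `ℝ × ℝ^{N-1}`. -/
def dX {N : ℕ} (φ : ℝ × Euc N → ℝ) (p : ℝ × Euc N) : ℝ :=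
  fderiv ℝ φ p (1, 0)

/-- The Laplacian `Δ_y` in the `y`-variables. -/
def lapY {N : ℕ} (φ : ℝ × Euc N → ℝ) (p : ℝ × Euc N) : ℝ :=
  ∑ i : Fin (N - 1),
    fderiv ℝ (fun q => fderiv ℝ φ q ((0 : ℝ), EuclideanSpace.single i (1 : ℝ))) p
      ((0 : ℝ), EuclideanSpace.single i (1 : ℝ))

/-- `u` is a distributional solution of `Δ_y u + β(y) u_x + γ(x,y) u = 0` on `S`:
for every test function `φ ∈ C_c^∞(S)`, `∫_S u · (Δ_y φ − β φ_x + γ φ) = 0`. -/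
def IsDistribSolution {N : ℕ} (S : Set (ℝ × Euc N)) (β : Euc N → ℝ)
    (γ u : ℝ × Euc N → ℝ) : Prop :=
  ∀ φ : ℝ × Euc N → ℝ, ContDiff ℝ (⊤ : ℕ∞) φ → HasCompactSupport φ → tsupport φ ⊆ S →
    ∫ p in S, u p * (lapY φ p - β p.2 * dX φ p + γ p * φ p) = 0

/-- The cylinder `(−5,6) × B_3(0)` of the normalized setting. -/
def cylD (N : ℕ) : Set (ℝ × Euc N) := Ioo (-5 : ℝ) 6 ×ˢ ball (0 : Euc N) 3

/-- `‖β‖_∞ := sup_{B_3(0)} |β|`. -/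
def supNormβ {N : ℕ} (β : Euc N → ℝ) : ℝ := sSup ((fun y => |β y|) '' ball (0 : Euc N) 3)

/-- `A_d^+ := {y ∈ B_1(0) | β(y) > d}`. -/
def Aplus {N : ℕ} (β : Euc N → ℝ) (d : ℝ) : Set (Euc N) :=
  {y ∈ ball (0 : Euc N) 1 | d < β y}

/-- `A_d^− := {y ∈ B_1(0) | −β(y) > d}`. -/
def Aminus {N : ℕ} (β : Euc N → ℝ) (d : ℝ) : Set (Euc N) :=
  {y ∈ ball (0 : Euc N) 1 | d < -β y}

open Filter Topology

/-- The second directional derivative as a second derivative along a line. -/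
lemma fderiv_fderiv_apply_eq_deriv {V : Type*} [NormedAddCommGroup V] [NormedSpace ℝ V]
    {φ : V → ℝ} {p : V} (hφ : ContDiffAt ℝ 2 φ p) (w : V) :
    fderiv ℝ (fun q => fderiv ℝ φ q w) p w = deriv (deriv fun t : ℝ => φ (p + t • w)) 0 := by
  have hline : ∀ t : ℝ, HasDerivAt (fun t : ℝ => p + t • w) w t := fun t => by
    simpa using ((hasDerivAt_id t).smul_const w).const_add p
  have hcont : Tendsto (fun t : ℝ => p + t • w) (𝓝 0) (𝓝 p) := by
    have := (hline 0).continuousAt.tendsto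
    simpa using this
  have h1 : ∀ᶠ q in 𝓝 p, ContDiffAt ℝ 2 φ q := hφ.eventually (by simp)
  have h2 : deriv (fun t : ℝ => φ (p + t • w)) =ᶠ[𝓝 0] fun t => fderiv ℝ φ (p + t • w) w := by
    filter_upwards [hcont.eventually h1] with t ht
    exact ((ht.differentiableAt (by simp)).hasFDerivAt.comp_hasDerivAt t (hline t)).deriv
  rw [h2.deriv_eq]
  have h3 : DifferentiableAt ℝ (fun q => fderiv ℝ φ q w) p :=
    ((hφ.fderiv_right (m := 1) (by norm_num)).differentiableAt (by simp)).clm_apply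
      (differentiableAt_const w)
  have h4 : HasFDerivAt (fun q => fderiv ℝ φ q w) (fderiv ℝ (fun q => fderiv ℝ φ q w) p)
      (p + (0 : ℝ) • w) := by simpa using h3.hasFDerivAt
  exact (h4.comp_hasDerivAt (0 : ℝ) (hline 0)).deriv.symm

lemma dX_eq_of_hasDerivAt {N : ℕ} {φ : ℝ × Euc N → ℝ} {p : ℝ × Euc N}
    (hφ : DifferentiableAt ℝ φ p) {a : ℝ} (h : HasDerivAt (fun x => φ (x, p.2)) a p.1) :
    dX φ p = a := by
  have hl : HasDerivAt (fun x : ℝ => (x, p.2)) ((1 : ℝ), (0 : Euc N)) p.1 :=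
    (hasDerivAt_id p.1).prodMk (hasDerivAt_const p.1 p.2)
  exact (HasFDerivAt.comp_hasDerivAt p.1 (f := fun x : ℝ => (x, p.2))
    (hφ.hasFDerivAt : HasFDerivAt φ _ (p.1, p.2)) hl).unique h

/-- A function that is radial about `c` in the variables `y`. -/
def radialY {N : ℕ} (c : Euc N) (Ψ : ℝ → ℝ → ℝ) (p : ℝ × Euc N) : ℝ := Ψ p.1 (‖p.2 - c‖ ^ 2)

lemma contDiffAt_radialY {N : ℕ} {c : Euc N} {Ψ : ℝ → ℝ → ℝ} {p : ℝ × Euc N} {m : WithTop ℕ∞}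
    (h : ContDiffAt ℝ m (fun z : ℝ × ℝ => Ψ z.1 z.2) (p.1, ‖p.2 - c‖ ^ 2)) :
    ContDiffAt ℝ m (radialY c Ψ) p := by
  have : ContDiffAt ℝ m (fun p : ℝ × Euc N => (p.1, ‖p.2 - c‖ ^ 2)) p := by
    refine contDiffAt_fst.prodMk ?_
    exact ((contDiffAt_snd.sub contDiffAt_const).norm_sq ℝ)
  exact ContDiffAt.comp (g := fun z : ℝ × ℝ => Ψ z.1 z.2) p h this

lemma dX_radialY {N : ℕ} {c : Euc N} {Ψ : ℝ → ℝ → ℝ} {p : ℝ × Euc N}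
    (hd : DifferentiableAt ℝ (radialY c Ψ) p) {a : ℝ}
    (h : HasDerivAt (fun x => Ψ x (‖p.2 - c‖ ^ 2)) a p.1) : dX (radialY c Ψ) p = a :=
  dX_eq_of_hasDerivAt hd h

lemma lapY_radialY {N : ℕ} {c : Euc N} {Ψ : ℝ → ℝ → ℝ} {p : ℝ × Euc N}
    (hΨ : ContDiffAt ℝ 2 (radialY c Ψ) p) {F' : ℝ → ℝ} {F'' : ℝ}
    (h1 : ∀ᶠ r in 𝓝 (‖p.2 - c‖ ^ 2), HasDerivAt (Ψ p.1) (F' r) r)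
    (h2 : HasDerivAt F' F'' (‖p.2 - c‖ ^ 2)) :
    lapY (radialY c Ψ) p
      = 4 * ‖p.2 - c‖ ^ 2 * F'' + 2 * ((N - 1 : ℕ) : ℝ) * F' (‖p.2 - c‖ ^ 2) := by
  set q := ‖p.2 - c‖ ^ 2 with hq
  have key : ∀ i : Fin (N - 1),
      fderiv ℝ (fun q => fderiv ℝ (radialY c Ψ) q ((0 : ℝ), EuclideanSpace.single i (1 : ℝ))) p
        ((0 : ℝ), EuclideanSpace.single i (1 : ℝ))
      = 4 * ((p.2 - c) i) ^ 2 * F'' + 2 * F' q := by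
    intro i
    rw [fderiv_fderiv_apply_eq_deriv hΨ]
    have e1 : (fun t : ℝ => radialY c Ψ (p + t • ((0 : ℝ), EuclideanSpace.single i (1 : ℝ))))
        = fun t : ℝ => Ψ p.1 (q + 2 * (p.2 - c) i * t + t ^ 2) := by
      funext t
      have : ‖p.2 + t • EuclideanSpace.single i (1 : ℝ) - c‖ ^ 2
          = q + 2 * (p.2 - c) i * t + t ^ 2 := by
        rw [add_sub_right_comm, norm_add_sq_real, inner_smul_right,
          EuclideanSpace.inner_single_right, norm_smul, PiLp.norm_single]
        simp [hq]
        ring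
      simp [radialY, this]
    rw [e1]
    have hin : ∀ t : ℝ, HasDerivAt (fun t : ℝ => q + 2 * (p.2 - c) i * t + t ^ 2)
        (2 * (p.2 - c) i + 2 * t) t := fun t => by
      have := (((hasDerivAt_id t).const_mul (2 * (p.2 - c) i)).const_add q).add
        ((hasDerivAt_id t).pow 2)
      refine this.congr_deriv ?_
      simp
    have hcont : Tendsto (fun t : ℝ => q + 2 * (p.2 - c) i * t + t ^ 2) (𝓝 0) (𝓝 q) := by
      have := (hin 0).continuousAt.tendsto
      simpa using this
    have e2 : deriv (fun t : ℝ => Ψ p.1 (q + 2 * (p.2 - c) i * t + t ^ 2)) =ᶠ[𝓝 0]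
        fun t => F' (q + 2 * (p.2 - c) i * t + t ^ 2) * (2 * (p.2 - c) i + 2 * t) := by
      filter_upwards [hcont.eventually h1] with t ht
      exact (HasDerivAt.comp t ht (hin t)).deriv
    rw [e2.deriv_eq]
    have h2' : HasDerivAt F' F'' (q + 2 * (p.2 - c) i * 0 + 0 ^ 2) := by simpa using h2
    have h3 := (HasDerivAt.comp (0 : ℝ) h2' (hin 0)).mul
      (((hasDerivAt_id (0 : ℝ)).const_mul 2).const_add (2 * (p.2 - c) i))
    refine (h3.congr_deriv ?_).deriv
    simp
    ring
  unfold lapY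
  rw [Finset.sum_congr rfl fun i _ => key i, Finset.sum_add_distrib, ← Finset.sum_mul,
    ← Finset.mul_sum, ← EuclideanSpace.real_norm_sq_eq]
  simp
  ring

lemma second_deriv_nonneg_of_isLocalMin {f : ℝ → ℝ} {x : ℝ} (h : IsLocalMin f x)
    (hc : ContinuousAt f x) : 0 ≤ deriv (deriv f) x := by
  by_contra! hneg
  have hmax := isLocalMax_of_deriv_deriv_neg hneg h.deriv_eq_zero hc
  have hconst : f =ᶠ[𝓝 x] fun _ => f x := by
    filter_upwards [h, hmax] with t h1 h2 using le_antisymm h2 h1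
  have : deriv f =ᶠ[𝓝 x] fun _ => 0 := by
    filter_upwards [hconst.eventuallyEq_nhds] with t ht
    rw [ht.deriv_eq]; simp
  rw [this.deriv_eq] at hneg
  simp at hneg

lemma lapY_nonneg_of_isLocalMin {N : ℕ} {φ : ℝ × Euc N → ℝ} {p : ℝ × Euc N}
    (hφ : ContDiffAt ℝ 2 φ p) (h : IsLocalMin φ p) : 0 ≤ lapY φ p := by
  refine Finset.sum_nonneg fun i _ => ?_
  rw [fderiv_fderiv_apply_eq_deriv hφ]
  have hc : ContinuousAt
      (fun t : ℝ => p + t • ((0 : ℝ), EuclideanSpace.single i (1 : ℝ))) 0 := by fun_prop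
  have h0 : p + (0 : ℝ) • ((0 : ℝ), EuclideanSpace.single i (1 : ℝ)) = p := by simp
  apply second_deriv_nonneg_of_isLocalMin
  · have := hc.tendsto
    rw [h0] at this
    filter_upwards [this.eventually h] with t ht
    simpa only [h0] using ht
  · refine ContinuousAt.comp (g := φ) ?_ hc
    rw [h0]; exact hφ.continuousAt

lemma dX_eq_zero_of_isLocalMin {N : ℕ} {φ : ℝ × Euc N → ℝ} {p : ℝ × Euc N}
    (h : IsLocalMin φ p) : dX φ p = 0 := by
  simp [dX, h.fderiv_eq_zero]

lemma lapY_sub {N : ℕ} {φ ψ : ℝ × Euc N → ℝ} {p : ℝ × Euc N}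
    (hφ : ContDiffAt ℝ 2 φ p) (hψ : ContDiffAt ℝ 2 ψ p) :
    lapY (fun q => φ q - ψ q) p = lapY φ p - lapY ψ p := by
  unfold lapY
  rw [← Finset.sum_sub_distrib]
  refine Finset.sum_congr rfl fun i _ => ?_
  set w : ℝ × Euc N := ((0 : ℝ), EuclideanSpace.single i (1 : ℝ))
  have e : (fun q => fderiv ℝ (fun q => φ q - ψ q) q w) =ᶠ[𝓝 p]
      fun q => fderiv ℝ φ q w - fderiv ℝ ψ q w := by
    filter_upwards [hφ.eventually (by simp), hψ.eventually (by simp)] with q h1 h2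
    rw [fderiv_fun_sub (h1.differentiableAt (by simp)) (h2.differentiableAt (by simp))]
    rfl
  have hd : ∀ {χ : ℝ × Euc N → ℝ}, ContDiffAt ℝ 2 χ p →
      DifferentiableAt ℝ (fun q => fderiv ℝ χ q w) p := fun h =>
    ((h.fderiv_right (m := 1) (by norm_num)).differentiableAt (by simp)).clm_apply
      (differentiableAt_const w)
  rw [e.fderiv_eq, fderiv_fun_sub (hd hφ) (hd hψ)]
  rfl

lemma dX_sub {N : ℕ} {φ ψ : ℝ × Euc N → ℝ} {p : ℝ × Euc N}
    (hφ : DifferentiableAt ℝ φ p) (hψ : DifferentiableAt ℝ ψ p) :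
    dX (fun q => φ q - ψ q) p = dX φ p - dX ψ p := by
  unfold dX
  rw [fderiv_fun_sub hφ hψ]
  rfl

/-- Bounds on the coefficient `β` in `B_3(0)`. -/
structure CoeffBound {N : ℕ} (β : Euc N → ℝ) (M : ℝ) : Prop where
  one_le : 1 ≤ M
  abs_bound : ∀ y ∈ ball (0 : Euc N) 3, |β y| ≤ M
  lip : ∀ y ∈ ball (0 : Euc N) 3, ∀ z ∈ ball (0 : Euc N) 3, |β y - β z| ≤ M * ‖y - z‖

/-- Bounded continuous nonnegative distributional solutions in the cylinder. -/
structure NonnegSolution {N : ℕ} (β : Euc N → ℝ) (γ u : ℝ × Euc N → ℝ) : Prop where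
  meas : Measurable γ
  abs_coeff : ∀ᵐ p ∂(volume.restrict (cylD N)), |γ p| ≤ 1
  cont : ContinuousOn u (cylD N)
  nonneg : ∀ p ∈ cylD N, 0 ≤ u p
  bdd : ∃ K : ℝ, ∀ p ∈ cylD N, u p ≤ K
  sol : IsDistribSolution (cylD N) β γ u

instance isAddHaarMeasure_volume_prod_euc {N : ℕ} :
    (volume : Measure (ℝ × Euc N)).IsAddHaarMeasure :=
  inferInstanceAs ((volume : Measure ℝ).prod (volume : Measure (Euc N))).IsAddHaarMeasure

lemma isOpen_cylD (N : ℕ) : IsOpen (cylD N) := isOpen_Ioo.prod isOpen_ball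

lemma volume_cylD_ne_top (N : ℕ) : volume (cylD N) ≠ ⊤ := by
  rw [cylD, Measure.volume_eq_prod, Measure.prod_prod]
  exact ENNReal.mul_ne_top (by simp) measure_ball_lt_top.ne

lemma NonnegSolution.integrableOn {N : ℕ} {β : Euc N → ℝ} {γ u : ℝ × Euc N → ℝ}
    (hu : NonnegSolution β γ u) : IntegrableOn u (cylD N) := by
  obtain ⟨K, hK⟩ := hu.bdd
  refine ⟨hu.cont.aestronglyMeasurable (isOpen_cylD N).measurableSet,
    .restrict_of_bounded (C := K) (volume_cylD_ne_top N).lt_top ?_⟩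
  filter_upwards [ae_restrict_mem (isOpen_cylD N).measurableSet] with p hp
  rw [Real.norm_eq_abs, abs_of_nonneg (hu.nonneg p hp)]
  exact hK p hp

lemma NonnegSolution.integrableOn_mul {N : ℕ} {β : Euc N → ℝ} {γ u : ℝ × Euc N → ℝ}
    (hu : NonnegSolution β γ u) {g : ℝ × Euc N → ℝ}
    (hg : AEStronglyMeasurable g (volume.restrict (cylD N))) {C : ℝ}
    (hC : ∀ᵐ p ∂(volume.restrict (cylD N)), |g p| ≤ C) :
    IntegrableOn (fun p => u p * g p) (cylD N) :=
  Integrable.mul_bdd (c := C) hu.integrableOn hg hC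

open ContinuousLinearMap in
lemma fderiv_convolution_apply {V : Type*} [NormedAddCommGroup V] [NormedSpace ℝ V]
    [FiniteDimensional ℝ V] [MeasurableSpace V] [BorelSpace V] {μ : Measure V} [SFinite μ]
    [μ.IsAddLeftInvariant] {f k : V → ℝ} (hf : LocallyIntegrable f μ) (hk : ContDiff ℝ 1 k)
    (hkc : HasCompactSupport k) (p w : V) :
    fderiv ℝ (convolution f k (mul ℝ ℝ) μ) p w
      = convolution f (fun a => fderiv ℝ k a w) (mul ℝ ℝ) μ p := by
  rw [(hkc.hasFDerivAt_convolution_right (mul ℝ ℝ) hf hk p).fderiv,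
    convolution_precompR_apply (mul ℝ ℝ) hf (hkc.fderiv ℝ) (hk.continuous_fderiv one_ne_zero)]

lemma fderiv_comp_const_sub_apply {V : Type*} [NormedAddCommGroup V] [NormedSpace ℝ V]
    {k : V → ℝ} (hk : Differentiable ℝ k) (p q w : V) :
    fderiv ℝ (fun a => k (p - a)) q w = - fderiv ℝ k (p - q) w := by
  have h := (hk (p - q)).hasFDerivAt.comp q ((hasFDerivAt_id q).const_sub p)
  have e : fderiv ℝ (fun a => k (p - a)) q = _ := h.fderiv
  rw [e]
  simp

lemma continuous_dX {N : ℕ} {k : ℝ × Euc N → ℝ} (hk : ContDiff ℝ 1 k) : Continuous (dX k) :=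
  (hk.continuous_fderiv one_ne_zero).clm_apply continuous_const

lemma contDiff_fderiv_apply {V : Type*} [NormedAddCommGroup V] [NormedSpace ℝ V] {k : V → ℝ}
    (hk : ContDiff ℝ 2 k) (w : V) : ContDiff ℝ 1 (fun q => fderiv ℝ k q w) :=
  (hk.fderiv_right (by norm_num)).clm_apply contDiff_const

lemma dX_comp_const_sub {N : ℕ} {k : ℝ × Euc N → ℝ} (hk : Differentiable ℝ k)
    (p q : ℝ × Euc N) : dX (fun a => k (p - a)) q = - dX k (p - q) :=
  fderiv_comp_const_sub_apply hk p q _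

lemma lapY_comp_const_sub {N : ℕ} {k : ℝ × Euc N → ℝ} (hk : ContDiff ℝ 2 k)
    (p q : ℝ × Euc N) : lapY (fun a => k (p - a)) q = lapY k (p - q) := by
  unfold lapY
  refine Finset.sum_congr rfl fun i _ => ?_
  simp_rw [fderiv_comp_const_sub_apply (hk.differentiable (by simp)) p]
  rw [fderiv_fun_neg]
  have := fderiv_comp_const_sub_apply
    ((contDiff_fderiv_apply hk ((0 : ℝ), EuclideanSpace.single i (1 : ℝ))).differentiable
      one_ne_zero) p q ((0 : ℝ), EuclideanSpace.single i (1 : ℝ))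
  simp only [neg_apply, this, neg_neg]

lemma continuous_lapY {N : ℕ} {k : ℝ × Euc N → ℝ} (hk : ContDiff ℝ 2 k) :
    Continuous (lapY k) :=
  continuous_finsetSum _ fun _ _ =>
    ((contDiff_fderiv_apply hk _).continuous_fderiv one_ne_zero).clm_apply continuous_const

lemma HasCompactSupport.dX {N : ℕ} {k : ℝ × Euc N → ℝ} (hk : HasCompactSupport k) :
    HasCompactSupport (dX k) := hk.fderiv_apply ℝ _

lemma HasCompactSupport.lapY {N : ℕ} {k : ℝ × Euc N → ℝ} (hk : HasCompactSupport k) :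
    HasCompactSupport (lapY k) := by
  have h : ∀ s : Finset (Fin (N - 1)), HasCompactSupport fun p => ∑ i ∈ s,
    fderiv ℝ (fun q => fderiv ℝ k q ((0 : ℝ), EuclideanSpace.single i (1 : ℝ))) p
      ((0 : ℝ), EuclideanSpace.single i (1 : ℝ)) := by
    intro s
    induction s using Finset.cons_induction with
    | empty => exact HasCompactSupport.zero (α := ℝ × Euc N)
    | cons a s ha ih =>
      simp_rw [Finset.sum_cons]
      exact HasCompactSupport.add ((hk.fderiv_apply ℝ _).fderiv_apply ℝ _) ih
  exact h Finset.univ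

open ContinuousLinearMap in
lemma lapY_convolution {N : ℕ} {f k : ℝ × Euc N → ℝ} (hf : LocallyIntegrable f volume)
    (hk : ContDiff ℝ 2 k) (hkc : HasCompactSupport k) (p : ℝ × Euc N) :
    lapY (convolution f k (mul ℝ ℝ) volume) p = ∫ q, f q * lapY k (p - q) := by
  unfold lapY
  simp_rw [Finset.mul_sum]
  rw [integral_finsetSum]
  · refine Finset.sum_congr rfl fun i _ => ?_
    simp_rw [fderiv_convolution_apply hf (hk.of_le (by norm_num)) hkc]
    rw [fderiv_convolution_apply hf (contDiff_fderiv_apply hk _) (hkc.fderiv_apply ℝ _)]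
    rfl
  · intro i _
    exact ((hkc.fderiv_apply ℝ _).fderiv_apply ℝ _).convolutionExists_right (mul ℝ ℝ) hf
      (((contDiff_fderiv_apply hk _).continuous_fderiv one_ne_zero).clm_apply
        continuous_const) p

lemma CoeffBound.aestronglyMeasurable {N : ℕ} {β : Euc N → ℝ} {M : ℝ}
    (hβ : CoeffBound β M) :
    AEStronglyMeasurable (fun q : ℝ × Euc N => β q.2) (volume.restrict (cylD N)) := by
  refine ContinuousOn.aestronglyMeasurable ?_ (isOpen_cylD N).measurableSet
  have : LipschitzOnWith (Real.toNNReal M) β (ball 0 3) :=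
    LipschitzOnWith.of_dist_le_mul fun y hy z hz => by
      rw [Real.coe_toNNReal _ (by linarith [hβ.one_le]), Real.dist_eq, dist_eq_norm]
      exact hβ.lip y hy z hz
  exact this.continuousOn.comp continuousOn_snd fun q hq => hq.2

open ContinuousLinearMap in
/-- Mollification: a solution is a local uniform limit of `C²` functions that are almost
supersolutions of `Δ_y v + β v_x = v`. -/
lemma NonnegSolution.exists_smooth_approx {N : ℕ} {β : Euc N → ℝ} {γ u : ℝ × Euc N → ℝ} {M : ℝ}
    (hβ : CoeffBound β M) (hu : NonnegSolution β γ u) {A : Set (ℝ × Euc N)} (hA : IsCompact A)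
    (hAs : A ⊆ cylD N) {e : ℝ} (he : 0 < e) :
    ∃ v : ℝ × Euc N → ℝ, ContDiff ℝ 2 v ∧ ∀ p ∈ A, |v p - u p| ≤ e ∧
      lapY v p + β p.2 * dX v p ≤ v p + e := by
  classical
  obtain ⟨K₀, hK₀⟩ := hu.bdd
  set K := max K₀ 0 with hKdef
  have hK0 : 0 ≤ K := le_max_right _ _
  have hK : ∀ p ∈ cylD N, u p ≤ K := fun p hp => (hK₀ p hp).trans (le_max_left _ _)
  have hM := hβ.one_le
  have hmeasD := (isOpen_cylD N).measurableSet
  set f : ℝ × Euc N → ℝ := (cylD N).indicator u with hf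
  have hfint : Integrable f := (integrable_indicator_iff hmeasD).2 hu.integrableOn
  have hfloc : LocallyIntegrable f volume := hfint.locallyIntegrable
  obtain ⟨δ₀, hδ₀, hthick⟩ := hA.exists_cthickening_subset_open (isOpen_cylD N) hAs
  have hA' : IsCompact (cthickening δ₀ A) := hA.cthickening
  have huc := hA'.uniformContinuousOn_of_continuous (hu.cont.mono hthick)
  obtain ⟨δ₁, hδ₁, huc⟩ := Metric.uniformContinuousOn_iff_le.1 huc e he
  set ρ := min δ₀ δ₁ with hρ
  have hρ0 : 0 < ρ := lt_min hδ₀ hδ₁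
  let η : ContDiffBump (0 : ℝ) := ⟨ρ / 2, ρ, by linarith, by linarith⟩
  set η' : ℝ → ℝ := η.normed volume with hη'
  have hηd : ContDiff ℝ 2 η' := η.contDiff_normed (n := 2)
  set C₁ := ∫ x, |deriv η' x| with hC₁
  have hC₁0 : 0 ≤ C₁ := integral_nonneg fun _ => abs_nonneg _
  set δ := min ρ (e / (K * M * C₁ + 1)) with hδ
  have hKMC : 0 ≤ K * M * C₁ := by positivity
  have hδ0 : 0 < δ := lt_min hρ0 (by positivity)
  let ζ : ContDiffBump (0 : Euc N) := ⟨δ / 2, δ, by linarith, by linarith⟩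
  set ζ' : Euc N → ℝ := ζ.normed volume with hζ'
  have hζd : ContDiff ℝ (⊤ : ℕ∞) ζ' := ζ.contDiff_normed
  have hηs : ∀ x, η' x ≠ 0 → |x| < ρ := fun x hx => by
    have : x ∈ Function.support η' := hx
    rw [hη', η.support_normed_eq] at this
    simpa using this
  have hζs : ∀ y, ζ' y ≠ 0 → ‖y‖ < δ := fun y hy => by
    have : y ∈ Function.support ζ' := hy
    rw [hζ', ζ.support_normed_eq] at this
    simpa using this
  set k : ℝ × Euc N → ℝ := fun p => η' p.1 * ζ' p.2 with hk
  have hkd : ContDiff ℝ (⊤ : ℕ∞) k :=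
    ((η.contDiff_normed (n := ⊤)).comp contDiff_fst).mul (hζd.comp contDiff_snd)
  have hkd2 : ContDiff ℝ 2 k := contDiff_infty.1 hkd 2
  have hk0 : ∀ p, 0 ≤ k p := fun p => mul_nonneg (η.nonneg_normed _) (ζ.nonneg_normed _)
  have hkball : Function.support k ⊆ ball 0 ρ := fun p hp => by
    have h1 := hηs _ (left_ne_zero_of_mul hp)
    have h2 := hζs _ (right_ne_zero_of_mul hp)
    rw [mem_ball_zero_iff, Prod.norm_def]
    exact max_lt h1 (h2.trans_le (min_le_left _ _))
  have hkc : HasCompactSupport k :=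
    HasCompactSupport.of_support_subset_isCompact (isCompact_closedBall 0 ρ)
      (hkball.trans ball_subset_closedBall)
  have hkint : ∫ p, k p = 1 := by
    rw [Measure.volume_eq_prod, integral_prod_mul]
    rw [η.integral_normed, ζ.integral_normed, one_mul]
  have hdXk : ∀ p, dX k p = deriv η' p.1 * ζ' p.2 := fun p =>
    dX_eq_of_hasDerivAt (hkd2.differentiable (by simp) p)
      ((hηd.differentiable (by simp) p.1).hasDerivAt.mul_const (ζ' p.2))
  set v := convolution f k (mul ℝ ℝ) volume with hv
  refine ⟨v, hkc.contDiff_convolution_right (n := 2) (mul ℝ ℝ) hfloc hkd2, fun p hp => ⟨?_, ?_⟩⟩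
  · have hflip : v = convolution k f (lsmul ℝ ℝ) volume := by
      rw [hv, ← convolution_flip]
      congr 1
      ext
      simp
    rw [hflip, ← Real.dist_eq]
    refine dist_convolution_le he.le hkball hk0 hkint hfint.aestronglyMeasurable fun q hq => ?_
    have hqp : dist q p < ρ := hq
    have hq' : q ∈ cthickening δ₀ A :=
      mem_cthickening_of_dist_le q p δ₀ A hp (hqp.le.trans (min_le_left _ _))
    rw [hf, indicator_of_mem (hthick hq')]
    exact huc q hq' p (self_subset_cthickening _ hp) (hqp.le.trans (min_le_right _ _))
  · have hvdX : dX v p = ∫ q, f q * dX k (p - q) :=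
      fderiv_convolution_apply hfloc (hkd2.of_le (by norm_num)) hkc p _
    have hvlap : lapY v p = ∫ q, f q * lapY k (p - q) := lapY_convolution hfloc hkd2 hkc p
    have hvp : v p = ∫ q, f q * k (p - q) := rfl
    have hind : ∀ g : ℝ × Euc N → ℝ, ∫ q, f q * g q = ∫ q in cylD N, u q * g q := fun g => by
      rw [← integral_indicator hmeasD]
      congr 1
      funext q
      by_cases hq : q ∈ cylD N <;> simp [hf, hq]
    have hbd : ∀ g : ℝ × Euc N → ℝ, Continuous g → HasCompactSupport g →
        ∃ C, ∀ q, |g (p - q)| ≤ C := fun g hg hgc => by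
      obtain ⟨C, hC⟩ := hgc.exists_bound_of_continuous hg
      exact ⟨C, fun q => hC _⟩
    have hsub : Continuous fun q : ℝ × Euc N => p - q := continuous_const.sub continuous_id
    have hintg : ∀ g : ℝ × Euc N → ℝ, Continuous g → HasCompactSupport g →
        IntegrableOn (fun q => u q * g (p - q)) (cylD N) := fun g hg hgc => by
      obtain ⟨C, hC⟩ := hbd g hg hgc
      exact hu.integrableOn_mul (hg.comp hsub).aestronglyMeasurable (.of_forall hC)
    have hdXc := continuous_dX (hkd2.of_le (by norm_num) : ContDiff ℝ 1 k)
    have htest := hu.sol (fun a => k (p - a)) (hkd.comp (contDiff_const.sub contDiff_id))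
      (hkc.comp_homeomorph (Homeomorph.subLeft p)) (by
        refine Subset.trans (closure_minimal (t := closedBall p ρ) ?_ isClosed_closedBall) ?_
        · intro q hq
          have := hkball (show p - q ∈ Function.support k from hq)
          rw [mem_ball_zero_iff] at this
          rw [mem_closedBall, dist_comm, dist_eq_norm]
          exact this.le
        · intro q hq
          exact hthick (mem_cthickening_of_dist_le q p δ₀ A hp
            ((mem_closedBall.1 hq).trans (min_le_left _ _))))
    simp_rw [lapY_comp_const_sub hkd2, dX_comp_const_sub (hkd2.differentiable (by simp))] at htest
    have hpD := hAs hp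
    have hI1 := hintg _ (continuous_lapY hkd2) hkc.lapY
    have hI2 := hintg _ hdXc hkc.dX
    have hI3 := hintg _ hkd.continuous hkc
    have hI4 : IntegrableOn (fun q => u q * (β q.2 * dX k (p - q))) (cylD N) := by
      obtain ⟨C, hC⟩ := hbd _ hdXc hkc.dX
      refine hu.integrableOn_mul (hβ.aestronglyMeasurable.mul (hdXc.comp hsub).aestronglyMeasurable)
        (C := M * C) ?_
      filter_upwards [ae_restrict_mem hmeasD] with q hq
      rw [abs_mul]
      have := hβ.abs_bound q.2 hq.2
      gcongr
      exact hC q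
    have hI5 : IntegrableOn (fun q => u q * (γ q * k (p - q))) (cylD N) := by
      obtain ⟨C, hC⟩ := hbd _ hkd.continuous hkc
      refine hu.integrableOn_mul (hu.meas.aestronglyMeasurable.mul
        (hkd.continuous.comp hsub).aestronglyMeasurable) (C := 1 * C) ?_
      filter_upwards [hu.abs_coeff] with q hq
      rw [abs_mul]
      gcongr
      exact hC q
    have hdXint : Integrable (fun q => |dX k (p - q)|) :=
      ((hdXc.integrable_of_hasCompactSupport hkc.dX).comp_sub_left p).abs
    have key : lapY v p + β p.2 * dX v p - v p ≤ K * (M * δ) * ∫ q, |dX k (p - q)| := by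
      calc lapY v p + β p.2 * dX v p - v p
          = (∫ q in cylD N, u q * lapY k (p - q)) + β p.2 * (∫ q in cylD N, u q * dX k (p - q))
            - (∫ q in cylD N, u q * k (p - q))
            - ∫ q in cylD N, u q * (lapY k (p - q) - β q.2 * -dX k (p - q)
              + γ q * k (p - q)) := by
            rw [htest, hvlap, hvdX, hvp]
            simp only [hind, sub_zero]
        _ = ∫ q in cylD N, u q * ((β p.2 - β q.2) * dX k (p - q) - (1 + γ q) * k (p - q)) := by
            have e1 : ∀ q, u q * (lapY k (p - q) - β q.2 * -dX k (p - q) + γ q * k (p - q))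
              = u q * lapY k (p - q) + u q * (β q.2 * dX k (p - q)) + u q * (γ q * k (p - q)) :=
              fun q => by ring
            have e2 : ∀ q, u q * ((β p.2 - β q.2) * dX k (p - q) - (1 + γ q) * k (p - q))
              = β p.2 * (u q * dX k (p - q)) - u q * (β q.2 * dX k (p - q))
                - u q * k (p - q) - u q * (γ q * k (p - q)) := fun q => by ring
            simp_rw [e1, e2]
            have j1 : IntegrableOn (fun q => u q * lapY k (p - q) + u q * (β q.2 * dX k (p - q)))
              (cylD N) := hI1.add hI4
            have j2 : IntegrableOn (fun q => β p.2 * (u q * dX k (p - q))) (cylD N) :=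
              hI2.const_mul _
            have j3 : IntegrableOn (fun q => β p.2 * (u q * dX k (p - q))
              - u q * (β q.2 * dX k (p - q))) (cylD N) := j2.sub hI4
            have j4 : IntegrableOn (fun q => β p.2 * (u q * dX k (p - q))
              - u q * (β q.2 * dX k (p - q)) - u q * k (p - q)) (cylD N) := j3.sub hI3
            rw [integral_add j1 hI5, integral_add hI1 hI4, integral_sub j4 hI5,
              integral_sub j3 hI3, integral_sub j2 hI4, integral_const_mul]
            ring
        _ ≤ ∫ q in cylD N, K * (M * δ) * |dX k (p - q)| := by
            refine integral_mono_ae ?_ (hdXint.const_mul _).integrableOn ?_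
            · have := ((((hI2.const_mul (β p.2)).sub hI4).sub hI3).sub hI5)
              refine this.congr (.of_forall fun q => ?_)
              simp only [Pi.sub_apply]
              ring
            · filter_upwards [hu.abs_coeff, ae_restrict_mem hmeasD] with q hq hqD
              have hu0 := hu.nonneg q hqD
              have h1 : 0 ≤ (1 + γ q) * k (p - q) :=
                mul_nonneg (by linarith [(abs_le.1 hq).1]) (hk0 _)
              have h2 : (β p.2 - β q.2) * dX k (p - q) ≤ M * δ * |dX k (p - q)| := by
                by_cases h0 : ζ' (p - q).2 = 0
                · rw [hdXk, h0]; simp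
                · have h3 := hζs _ h0
                  refine (le_abs_self _).trans ?_
                  rw [abs_mul]
                  have h4 := hβ.lip p.2 hpD.2 q.2 hqD.2
                  have h5 : M * ‖p.2 - q.2‖ ≤ M * δ := by
                    gcongr
                    exact h3.le
                  gcongr
                  exact h4.trans h5
              have h6 : 0 ≤ M * δ * |dX k (p - q)| := by positivity
              calc u q * ((β p.2 - β q.2) * dX k (p - q) - (1 + γ q) * k (p - q))
                  ≤ u q * (M * δ * |dX k (p - q)|) := by gcongr; linarith
                _ ≤ K * (M * δ * |dX k (p - q)|) := by gcongr; exact hK q hqD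
                _ = _ := by ring
        _ ≤ ∫ q, K * (M * δ) * |dX k (p - q)| :=
            setIntegral_le_integral (hdXint.const_mul _) (.of_forall fun q => by positivity)
        _ = _ := integral_const_mul _ _
    have hval : ∫ q, |dX k (p - q)| = C₁ := by
      rw [integral_sub_left_eq_self (fun q => |dX k q|) volume p]
      have : ∀ q : ℝ × Euc N, |dX k q| = |deriv η' q.1| * ζ' q.2 := fun q => by
        rw [hdXk, abs_mul, abs_of_nonneg (ζ.nonneg_normed q.2 : 0 ≤ ζ' q.2)]
      simp_rw [this]
      rw [Measure.volume_eq_prod, integral_prod_mul (fun x => |deriv η' x|) ζ',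
        ζ.integral_normed, mul_one]
    rw [hval] at key
    have hfin : K * (M * δ) * C₁ ≤ e := by
      have h1 : δ ≤ e / (K * M * C₁ + 1) := min_le_right _ _
      rw [le_div_iff₀ (by positivity)] at h1
      nlinarith
    linarith

/-- Comparison with smooth subsolutions of `Δ_y w + β w_x = w`. -/
lemma NonnegSolution.le_of_subsolution {N : ℕ} {β : Euc N → ℝ} {γ u : ℝ × Euc N → ℝ} {M : ℝ}
    (hβ : CoeffBound β M) (hu : NonnegSolution β γ u) {A : Set (ℝ × Euc N)} (hA : IsCompact A)
    (hAs : A ⊆ cylD N) {w : ℝ × Euc N → ℝ} (hw : ContDiff ℝ 2 w)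
    (h : ∀ p ∈ A, w p ≤ u p ∨ (p ∈ interior A ∧ w p ≤ lapY w p + β p.2 * dX w p)) :
    ∀ p ∈ A, w p ≤ u p := by
  by_contra! hcon
  obtain ⟨p, hp, hpu⟩ := hcon
  set e := (w p - u p) / 4 with he
  have he0 : 0 < e := by rw [he]; linarith
  obtain ⟨v, hv, hvA⟩ := hu.exists_smooth_approx hβ hA hAs he0
  obtain ⟨q, hq, hmin⟩ := hA.exists_isMinOn ⟨p, hp⟩
    (f := fun p => v p - w p) (hv.continuous.sub hw.continuous).continuousOn
  have h1 : v q - w q ≤ v p - w p := hmin hp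
  have h2 := abs_le.1 (hvA p hp).1
  have h3 := abs_le.1 (hvA q hq).1
  rcases h q hq with h4 | ⟨h4, h5⟩
  · linarith
  · have hloc : IsLocalMin (fun p => v p - w p) q :=
      hmin.isLocalMin (mem_interior_iff_mem_nhds.1 h4)
    have hl := lapY_nonneg_of_isLocalMin (hv.sub hw).contDiffAt hloc
    have hd := dX_eq_zero_of_isLocalMin hloc
    rw [lapY_sub hv.contDiffAt hw.contDiffAt] at hl
    rw [dX_sub (hv.differentiable (by simp) q) (hw.differentiable (by simp) q)] at hd
    have h6 := (hvA q hq).2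
    have h7 : dX v q = dX w q := by linarith
    rw [h7] at h6
    linarith

/-- Propagation of positivity along the drift direction, on a ball where `β` has a sign. -/
lemma exists_drift_const (N : ℕ) {r d T : ℝ} (hr : 0 < r) (hd : 0 < d) :
    ∃ c > 0, ∀ {β : Euc N → ℝ} {γ u : ℝ × Euc N → ℝ} {M : ℝ}, CoeffBound β M →
      NonnegSolution β γ u → ∀ {ς : ℝ}, (ς = 1 ∨ ς = -1) → ∀ {yc : Euc N} {xa m : ℝ}, 0 ≤ m →
      closedBall yc r ⊆ ball 0 3 → (∀ y ∈ closedBall yc r, d ≤ ς * β y) →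
      xa ∈ Ioo (-5 : ℝ) 6 → xa - ς * T ∈ Ioo (-5 : ℝ) 6 →
      (∀ y ∈ closedBall yc r, m ≤ u (xa, y)) →
      ∀ x, 0 ≤ ς * (xa - x) → ς * (xa - x) ≤ T - 1 →
      ∀ y ∈ closedBall yc (r / 2), c * m ≤ u (x, y) := by
  set n : ℝ := ((N - 1 : ℕ) : ℝ) with hn
  have hn0 : 0 ≤ n := Nat.cast_nonneg _
  set Λ := ((8 + 4 * n) ^ 2 / (32 * r ^ 2) + 1) / d with hΛ
  have hΛ0 : 0 < Λ := by positivity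
  have hdΛ : d * Λ = (8 + 4 * n) ^ 2 / (32 * r ^ 2) + 1 := by
    rw [hΛ]; field_simp
  refine ⟨(Real.exp (-(Λ * (T - 1))) - Real.exp (-(Λ * T))) * (9 / 16), ?_, ?_⟩
  · have : Real.exp (-(Λ * T)) < Real.exp (-(Λ * (T - 1))) := by
      rw [Real.exp_lt_exp]; nlinarith
    linarith
  intro β γ u M hβ hu ς hς yc xa m hm hball hdrift hxa hxb hstart x hx0 hxT y hy
  have hςς : ς * ς = 1 := by rcases hς with h | h <;> rw [h] <;> norm_num
  set A : Set (ℝ × Euc N) := {x | ς * (xa - x) ∈ Icc 0 T} ×ˢ closedBall yc r with hA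
  have hIoo : ∀ x, ς * (xa - x) ∈ Icc 0 T → x ∈ Ioo (-5 : ℝ) 6 := fun x hx => by
    obtain ⟨h1, h2⟩ := hx
    obtain ⟨h3, h4⟩ := hxa
    obtain ⟨h5, h6⟩ := hxb
    rcases hς with h | h <;> rw [h] at h1 h2 h5 h6 <;> constructor <;> linarith
  have hclosed : IsClosed {x | ς * (xa - x) ∈ Icc 0 T} :=
    isClosed_Icc.preimage (by fun_prop : Continuous fun x => ς * (xa - x))
  have hAc : IsCompact A := by
    refine IsCompact.prod ?_ (isCompact_closedBall _ _)
    exact (isCompact_Icc (a := (-5 : ℝ)) (b := 6)).of_isClosed_subset hclosed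
      fun x hx => Ioo_subset_Icc_self (hIoo x hx)
  have hAD : A ⊆ cylD N := fun p hp => ⟨hIoo _ hp.1, hball hp.2⟩
  set Ψ : ℝ → ℝ → ℝ := fun x q => m / r ^ 4 *
    (Real.exp (-(Λ * (ς * (xa - x)))) - Real.exp (-(Λ * T))) * (r ^ 2 - q) ^ 2 with hΨ
  have hΨd : ContDiff ℝ 2 (fun z : ℝ × ℝ => Ψ z.1 z.2) := by
    simp only [hΨ]; fun_prop
  have hw : ContDiff ℝ 2 (radialY yc Ψ) :=
    contDiff_iff_contDiffAt.2 fun p => contDiffAt_radialY hΨd.contDiffAt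
  have key := hu.le_of_subsolution hβ hAc hAD hw (fun p hp => ?_) (x, y)
    ⟨⟨hx0, by linarith⟩, closedBall_subset_closedBall (by linarith) hy⟩
  · refine le_trans ?_ key
    simp only [radialY, hΨ]
    have hq : ‖y - yc‖ ^ 2 ≤ (r / 2) ^ 2 := by
      have : ‖y - yc‖ ≤ r / 2 := by simpa [dist_eq_norm] using hy
      gcongr
    have h1 : 9 / 16 * r ^ 4 ≤ (r ^ 2 - ‖y - yc‖ ^ 2) ^ 2 := by
      nlinarith [sq_nonneg r]
    have h2 : Real.exp (-(Λ * (T - 1))) ≤ Real.exp (-(Λ * (ς * (xa - x)))) := by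
      gcongr
    have h3 : Real.exp (-(Λ * T)) ≤ Real.exp (-(Λ * (T - 1))) := by
      rw [Real.exp_le_exp]; nlinarith
    calc _ = m / r ^ 4 * (Real.exp (-(Λ * (T - 1))) - Real.exp (-(Λ * T))) * (9 / 16 * r ^ 4) := by
          field_simp
      _ ≤ _ := by
          gcongr
          · have := sub_nonneg.2 (h3.trans h2); positivity
  · obtain ⟨⟨ht0, htT⟩, hpy⟩ := hp
    set t := ς * (xa - p.1) with ht
    set q := ‖p.2 - yc‖ ^ 2 with hq
    have hpy' : ‖p.2 - yc‖ ≤ r := by simpa [dist_eq_norm] using hpy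
    have hq0 : 0 ≤ q := by positivity
    have hqr : q ≤ r ^ 2 := by rw [hq]; gcongr
    have hu0 : 0 ≤ u p := hu.nonneg p (hAD ⟨⟨ht0, htT⟩, hpy⟩)
    have hwp : radialY yc Ψ p
        = m / r ^ 4 * (Real.exp (-(Λ * t)) - Real.exp (-(Λ * T))) * (r ^ 2 - q) ^ 2 := rfl
    have hθ : 0 ≤ Real.exp (-(Λ * t)) - Real.exp (-(Λ * T)) := by
      rw [sub_nonneg]; gcongr
    rcases ht0.eq_or_lt with h0 | h0
    · left
      have hx : p.1 = xa := by
        have : ς * t = 0 := by rw [← h0, mul_zero]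
        rw [ht, ← mul_assoc, hςς] at this
        linarith
      have h1 := hstart p.2 hpy
      rw [← hx] at h1
      refine le_trans ?_ h1
      rw [hwp, ← h0]
      calc _ ≤ m / r ^ 4 * 1 * (r ^ 2) ^ 2 := by
            gcongr
            · simp [(Real.exp_pos _).le]
            · linarith
        _ = m := by field_simp
    rcases htT.eq_or_lt with h1 | h1
    · left; rw [hwp, h1]; simpa using hu0
    rcases hpy'.eq_or_lt with h2 | h2
    · left; rw [hwp, hq, h2]; simpa using hu0
    right
    constructor
    · have ho : IsOpen ({x | ς * (xa - x) ∈ Ioo 0 T} ×ˢ ball yc r) :=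
        (isOpen_Ioo.preimage (by fun_prop : Continuous fun x => ς * (xa - x))).prod isOpen_ball
      have hsub : {x | ς * (xa - x) ∈ Ioo 0 T} ×ˢ ball yc r ⊆ A := fun z hz =>
        ⟨Ioo_subset_Icc_self hz.1, ball_subset_closedBall hz.2⟩
      refine interior_maximal hsub ho ⟨⟨h0, h1⟩, ?_⟩
      simpa [dist_eq_norm] using h2
    · have hdX : dX (radialY yc Ψ) p
          = m / r ^ 4 * (Λ * ς * Real.exp (-(Λ * t))) * (r ^ 2 - q) ^ 2 := by
        refine dX_radialY (hw.differentiable (by simp) p) ?_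
        have e1 : HasDerivAt (fun x => -(Λ * (ς * (xa - x)))) (Λ * ς) p.1 := by
          have := ((((hasDerivAt_id p.1).const_sub xa).const_mul ς).const_mul Λ).neg
          exact this.congr_deriv (by ring)
        have := ((e1.exp.sub_const (Real.exp (-(Λ * T)))).const_mul (m / r ^ 4)).mul_const
          ((r ^ 2 - q) ^ 2)
        exact this.congr_deriv (by simp only [ht]; ring)
      have hlap := lapY_radialY (c := yc) (Ψ := Ψ) (p := p) hw.contDiffAt
        (F' := fun q => m / r ^ 4 * (Real.exp (-(Λ * t)) - Real.exp (-(Λ * T)))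
          * (-2 * (r ^ 2 - q)))
        (F'' := m / r ^ 4 * (Real.exp (-(Λ * t)) - Real.exp (-(Λ * T))) * 2)
        (.of_forall fun q => by
          have := (((hasDerivAt_id q).const_sub (r ^ 2)).pow 2).const_mul
            (m / r ^ 4 * (Real.exp (-(Λ * t)) - Real.exp (-(Λ * T))))
          exact this.congr_deriv (by simp; try ring))
        (by
          have := (((hasDerivAt_id q).const_sub (r ^ 2)).const_mul (-2)).const_mul
            (m / r ^ 4 * (Real.exp (-(Λ * t)) - Real.exp (-(Λ * T))))
          exact this.congr_deriv (by simp))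
      rw [hlap, hdX, hwp]
      have hb := hdrift p.2 hpy
      set θ := Real.exp (-(Λ * t)) - Real.exp (-(Λ * T)) with hθdef
      have hE : θ ≤ Real.exp (-(Λ * t)) := by
        rw [hθdef]; linarith [Real.exp_pos (-(Λ * T))]
      have hmr : 0 ≤ m / r ^ 4 := by positivity
      have e1 : d * Λ * (θ * (r ^ 2 - q) ^ 2)
          ≤ ς * β p.2 * Λ * (Real.exp (-(Λ * t)) * (r ^ 2 - q) ^ 2) := by
        have : 0 ≤ ς * β p.2 := by linarith
        gcongr
      have e2 : 0 ≤ 8 * q - 4 * n * (r ^ 2 - q) + (d * Λ - 1) * (r ^ 2 - q) ^ 2 := by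
        have : 8 * q - 4 * n * (r ^ 2 - q) + (d * Λ - 1) * (r ^ 2 - q) ^ 2
            = ((8 + 4 * n) * (r ^ 2 - q) - 16 * r ^ 2) ^ 2 / (32 * r ^ 2) := by
          rw [hdΛ]; field_simp; ring
        rw [this]; positivity
      have e3 := mul_nonneg hmr (mul_nonneg hθ e2)
      have e4 := mul_le_mul_of_nonneg_left e1 hmr
      simp only [← hq, ← hn]
      linarith

set_option maxHeartbeats 400000 in
/-- Spreading of positivity in the `y`-directions. -/
lemma exists_spread_const (N : ℕ) {M r R R' ε : ℝ} (hM : 1 ≤ M) (hr : 0 < r) (hR' : 0 ≤ R')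
    (hR : R' < R) (hε : 0 < ε) :
    ∃ c > 0, ∀ {β : Euc N → ℝ} {γ u : ℝ × Euc N → ℝ}, CoeffBound β M →
      NonnegSolution β γ u → ∀ {yc : Euc N} {xc m : ℝ}, 0 ≤ m →
      closedBall yc R ⊆ ball 0 3 → Icc (xc - ε) (xc + ε) ⊆ Ioo (-5 : ℝ) 6 →
      (∀ x ∈ Icc (xc - ε) (xc + ε), ∀ y ∈ closedBall yc r, m ≤ u (x, y)) →
      ∀ y ∈ closedBall yc R', c * m ≤ u (xc, y) := by
  set n : ℝ := ((N - 1 : ℕ) : ℝ) with hn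
  have hn0 : 0 ≤ n := Nat.cast_nonneg _
  have hR0 : 0 < R := by linarith
  set k := (2 * n + 2 * M * R ^ 2 / ε + 1) / (4 * r ^ 2) + 1 with hk
  have hk1 : 1 ≤ k := by
    rw [hk]
    have : 0 ≤ (2 * n + 2 * M * R ^ 2 / ε + 1) / (4 * r ^ 2) := by positivity
    linarith
  have hkr : 4 * k * r ^ 2 = 2 * n + 2 * M * R ^ 2 / ε + 1 + 4 * r ^ 2 := by
    rw [hk]; field_simp
  set Λ := k * R ^ 2 / ε ^ 2 with hΛ
  have hΛ0 : 0 ≤ Λ := by positivity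
  have hΛε : Λ * ε ^ 2 = k * R ^ 2 := by rw [hΛ]; field_simp
  have hkey : 1 ≤ 4 * k ^ 2 * r ^ 2 - 2 * n * k - 2 * M * Λ * ε := by
    have : 4 * k ^ 2 * r ^ 2 - 2 * n * k - 2 * M * Λ * ε = k * (1 + 4 * r ^ 2) := by
      have h1 : 4 * k ^ 2 * r ^ 2 = k * (2 * n + 2 * M * R ^ 2 / ε + 1 + 4 * r ^ 2) := by
        rw [← hkr]; ring
      rw [h1, hΛ]; field_simp; ring
    rw [this]
    nlinarith [sq_nonneg r]
  refine ⟨Real.exp (-(k * R' ^ 2)) - Real.exp (-(k * R ^ 2)), ?_, ?_⟩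
  · rw [gt_iff_lt, sub_pos, Real.exp_lt_exp]
    have : R' ^ 2 < R ^ 2 := by gcongr
    nlinarith
  intro β γ u hβ hu yc xc m hm hball hIcc hstart y hy
  set A : Set (ℝ × Euc N) := Icc (xc - ε) (xc + ε) ×ˢ closedBall yc R with hA
  have hAc : IsCompact A := isCompact_Icc.prod (isCompact_closedBall _ _)
  have hAD : A ⊆ cylD N := fun p hp => ⟨hIcc hp.1, hball hp.2⟩
  set Ψ : ℝ → ℝ → ℝ := fun x q =>
    m * (Real.exp (-(k * q) - Λ * (x - xc) ^ 2) - Real.exp (-(k * R ^ 2))) with hΨ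
  have hΨd : ContDiff ℝ 2 (fun z : ℝ × ℝ => Ψ z.1 z.2) := by
    simp only [hΨ]; fun_prop
  have hw : ContDiff ℝ 2 (radialY yc Ψ) :=
    contDiff_iff_contDiffAt.2 fun p => contDiffAt_radialY hΨd.contDiffAt
  have key := hu.le_of_subsolution hβ hAc hAD hw (fun p hp => ?_) (xc, y)
    ⟨⟨by linarith, by linarith⟩, closedBall_subset_closedBall hR.le hy⟩
  · refine le_trans ?_ key
    simp only [radialY, hΨ]
    have hq : ‖y - yc‖ ≤ R' := by simpa [dist_eq_norm] using hy
    rw [mul_comm, sub_self]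
    gcongr
    have : ‖y - yc‖ ^ 2 ≤ R' ^ 2 := by gcongr
    nlinarith
  · obtain ⟨hpx, hpy⟩ := hp
    set q := ‖p.2 - yc‖ ^ 2 with hq
    have hpy' : ‖p.2 - yc‖ ≤ R := by simpa [dist_eq_norm] using hpy
    have hq0 : 0 ≤ q := by positivity
    have hu0 : 0 ≤ u p := hu.nonneg p (hAD ⟨hpx, hpy⟩)
    have hwp : radialY yc Ψ p
        = m * (Real.exp (-(k * q) - Λ * (p.1 - xc) ^ 2) - Real.exp (-(k * R ^ 2))) := rfl
    have hpx' : |p.1 - xc| ≤ ε := by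
      rw [abs_le]; constructor <;> linarith [hpx.1, hpx.2]
    by_cases hzero : k * R ^ 2 ≤ k * q + Λ * (p.1 - xc) ^ 2
    · left
      refine le_trans ?_ hu0
      rw [hwp]
      refine mul_nonpos_of_nonneg_of_nonpos hm ?_
      rw [sub_nonpos, Real.exp_le_exp]
      linarith
    by_cases hin : ‖p.2 - yc‖ ≤ r
    · left
      refine le_trans ?_ (hstart p.1 hpx p.2 (by simpa [dist_eq_norm] using hin))
      rw [hwp]
      have : Real.exp (-(k * q) - Λ * (p.1 - xc) ^ 2) ≤ 1 := by
        rw [Real.exp_le_one_iff]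
        have : 0 ≤ k * q + Λ * (p.1 - xc) ^ 2 := by positivity
        linarith
      have h2 := Real.exp_pos (-(k * R ^ 2))
      nlinarith
    push Not at hzero hin
    right
    constructor
    · have ho : IsOpen (Ioo (xc - ε) (xc + ε) ×ˢ ball yc R) := isOpen_Ioo.prod isOpen_ball
      refine interior_maximal (Set.prod_mono Ioo_subset_Icc_self ball_subset_closedBall) ho ⟨?_, ?_⟩
      · have : |p.1 - xc| < ε := by
          refine lt_of_le_of_ne hpx' fun h => ?_
          rw [← sq_abs, h, hΛε] at hzero
          nlinarith
        rw [abs_lt] at this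
        constructor <;> linarith
      · rw [mem_ball, dist_eq_norm]
        refine lt_of_le_of_ne hpy' fun h => ?_
        rw [hq, h] at hzero
        nlinarith [mul_nonneg hΛ0 (sq_nonneg (p.1 - xc))]
    · have hqr : r ^ 2 ≤ q := by rw [hq]; gcongr
      set E := Real.exp (-(k * q) - Λ * (p.1 - xc) ^ 2) with hE
      have hdX : dX (radialY yc Ψ) p = m * (E * (-(2 * Λ * (p.1 - xc)))) := by
        refine dX_radialY (hw.differentiable (by simp) p) ?_
        have e1 : HasDerivAt (fun x => -(k * q) - Λ * (x - xc) ^ 2) (-(2 * Λ * (p.1 - xc))) p.1 := by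
          have := ((((hasDerivAt_id p.1).sub_const xc).pow 2).const_mul Λ).const_sub (-(k * q))
          exact this.congr_deriv (by simp; ring)
        exact (e1.exp.sub_const _).const_mul m
      have hin : ∀ q, HasDerivAt (fun q => -(k * q) - Λ * (p.1 - xc) ^ 2) (-k) q := fun q => by
        have := (((hasDerivAt_id q).const_mul k).neg).sub_const (Λ * (p.1 - xc) ^ 2)
        exact this.congr_deriv (by simp)
      have hlap := lapY_radialY (c := yc) (Ψ := Ψ) (p := p) hw.contDiffAt
        (F' := fun q => m * (Real.exp (-(k * q) - Λ * (p.1 - xc) ^ 2) * -k))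
        (F'' := m * (E * -k * -k))
        (.of_forall fun q => ((hin q).exp.sub_const _).const_mul m)
        (((hin q).exp.mul_const (-k)).const_mul m)
      rw [hlap, hdX, hwp]
      have hE0 : 0 < E := Real.exp_pos _
      have hb : |β p.2 * (-(2 * Λ * (p.1 - xc)))| ≤ M * (2 * Λ * ε) := by
        rw [abs_mul, abs_neg, abs_mul, abs_of_nonneg (by positivity : 0 ≤ 2 * Λ)]
        have := hβ.abs_bound p.2 (hball hpy)
        gcongr
      have hb' := (abs_le.1 hb).1
      have hfin : 1 ≤ 4 * q * k ^ 2 - 2 * n * k + β p.2 * (-(2 * Λ * (p.1 - xc))) := by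
        have : 4 * k ^ 2 * r ^ 2 ≤ 4 * q * k ^ 2 := by
          have := mul_le_mul_of_nonneg_left hqr (by positivity : 0 ≤ 4 * k ^ 2)
          linarith
        linarith
      have h5 := mul_le_mul_of_nonneg_left hfin (mul_nonneg hm hE0.le)
      have h6 : 0 ≤ m * Real.exp (-(k * R ^ 2)) := by positivity
      simp only [← hq, ← hE, ← hn]
      linarith

/-- The logarithm of the (perturbed) Gaussian kernel with pole at `s = 0`, as a function of the
time `s` and of the squared distance `q`. -/
def logKer (n b₀ lam kap s q : ℝ) : ℝ :=
  -(n / 2) * Real.log s - b₀ * q / (4 * s) - kap * √(q + lam * s) ^ 3 / s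

lemma hasDerivAt_sqrt_cube {z : ℝ} (hz : 0 < z) :
    HasDerivAt (fun z => √z ^ 3) (3 / 2 * √z) z := by
  refine ((Real.hasDerivAt_sqrt hz.ne').pow 3).congr_deriv ?_
  have := Real.sqrt_pos.2 hz
  norm_num
  field_simp

lemma hasDerivAt_logKer_space {n b₀ lam kap s q : ℝ} (hq : 0 < q + lam * s) :
    HasDerivAt (logKer n b₀ lam kap s)
      (-b₀ / (4 * s) - 3 / 2 * kap * √(q + lam * s) / s) q := by
  have h1 : HasDerivAt (fun q => √(q + lam * s) ^ 3) (3 / 2 * √(q + lam * s)) q := by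
    have := (hasDerivAt_sqrt_cube hq).comp q ((hasDerivAt_id q).add_const (lam * s))
    exact this.congr_deriv (by simp)
  have h2 : HasDerivAt (fun q => b₀ * q / (4 * s)) (b₀ / (4 * s)) q := by
    have := ((hasDerivAt_id q).const_mul b₀).div_const (4 * s)
    exact this.congr_deriv (by simp)
  have h3 := ((h2.const_sub (-(n / 2) * Real.log s))).sub ((h1.const_mul kap).div_const s)
  exact h3.congr_deriv (by ring)

lemma hasDerivAt_logKer_space_deriv {b₀ lam kap s q : ℝ} (hq : 0 < q + lam * s) :
    HasDerivAt (fun q => -b₀ / (4 * s) - 3 / 2 * kap * √(q + lam * s) / s)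
      (-(3 / 4 * kap / (√(q + lam * s) * s))) q := by
  have h1 : HasDerivAt (fun q => √(q + lam * s)) (1 / (2 * √(q + lam * s))) q := by
    have := (Real.hasDerivAt_sqrt hq.ne').comp q ((hasDerivAt_id q).add_const (lam * s))
    exact this.congr_deriv (by simp)
  refine (((h1.const_mul (3 / 2 * kap)).div_const s).const_sub (-b₀ / (4 * s))).congr_deriv ?_
  have := Real.sqrt_pos.2 hq
  rcases eq_or_ne s 0 with rfl | hs
  · simp
  field_simp
  ring

lemma hasDerivAt_logKer_time {n b₀ lam kap s q : ℝ} (hs : 0 < s) (hq : 0 < q + lam * s) :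
    HasDerivAt (fun s => logKer n b₀ lam kap s q)
      (-n / (2 * s) + b₀ * q / (4 * s ^ 2)
        - kap * (3 / 2 * lam * √(q + lam * s) / s - √(q + lam * s) ^ 3 / s ^ 2)) s := by
  have h1 : HasDerivAt (fun s => √(q + lam * s) ^ 3) (3 / 2 * √(q + lam * s) * lam) s := by
    have := (hasDerivAt_sqrt_cube hq).comp s (((hasDerivAt_id s).const_mul lam).const_add q)
    exact this.congr_deriv (by simp)
  have h2 := (Real.hasDerivAt_log hs.ne').const_mul (-(n / 2))
  have h3 : HasDerivAt (fun s => b₀ * q / (4 * s)) (-(b₀ * q / (4 * s ^ 2))) s := by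
    have := (hasDerivAt_const s (b₀ * q)).div ((hasDerivAt_id s).const_mul 4)
      (by simpa using hs.ne')
    refine this.congr_deriv ?_
    simp only [id]
    field_simp
    ring
  have h4 := (h1.const_mul kap).div (hasDerivAt_id s) hs.ne'
  refine ((h2.sub h3).sub h4).congr_deriv ?_
  simp only [id]
  field_simp
  ring

lemma contDiffAt_logKer {n b₀ lam kap s q : ℝ} (hs : 0 < s) (hq : 0 < q + lam * s)
    {m : WithTop ℕ∞} :
    ContDiffAt ℝ m (fun z : ℝ × ℝ => logKer n b₀ lam kap z.1 z.2) (s, q) := by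
  have h1 : ContDiffAt ℝ m (fun z : ℝ × ℝ => Real.log z.1) (s, q) :=
    contDiffAt_fst.log hs.ne'
  have h2 : ContDiffAt ℝ m (fun z : ℝ × ℝ => √(z.2 + lam * z.1)) (s, q) :=
    (contDiffAt_snd.add (contDiffAt_const.mul contDiffAt_fst)).sqrt hq.ne'
  refine ((contDiffAt_const.mul h1).sub ((contDiffAt_const.mul contDiffAt_snd).div
    (contDiffAt_const.mul contDiffAt_fst) ?_)).sub
    ((contDiffAt_const.mul (h2.pow 3)).div contDiffAt_fst hs.ne')
  simpa using hs.ne'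

/-- The adjoint operator applied to `exp (logKer ..)`, divided by `exp (logKer ..)`. -/
def adjKer (n b₀ lam kap b s q : ℝ) : ℝ :=
  2 * n * (-b₀ / (4 * s) - 3 / 2 * kap * √(q + lam * s) / s)
    + 4 * q * (-(3 / 4 * kap / (√(q + lam * s) * s))
      + (-b₀ / (4 * s) - 3 / 2 * kap * √(q + lam * s) / s) ^ 2)
    - b * (-n / (2 * s) + b₀ * q / (4 * s ^ 2)
        - kap * (3 / 2 * lam * √(q + lam * s) / s - √(q + lam * s) ^ 3 / s ^ 2))

lemma two_le_mul_adjKer {n b₀ lam k b s q σ : ℝ} (hn : 0 ≤ n) (hs : 0 < s) (hs1 : s ≤ 1)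
    (hq : 0 ≤ q) (hk : 1 ≤ k) (hσ : σ = 1 ∨ σ = -1) (hb₀ : 0 < b₀)
    (hb : |b - b₀| ≤ k * √(q + lam * s)) (hR : 18 * k * √(q + lam * s) ≤ b₀) (hlam : 4 ≤ lam)
    (hlam' : n / 2 + 3 * n + 4 ≤ b₀ * lam / 4) :
    2 ≤ σ * adjKer n b₀ lam (σ * k) b s q := by
  have hz : 0 < q + lam * s := by positivity
  set R := √(q + lam * s) with hRdef
  have hR0 : 0 < R := Real.sqrt_pos.2 hz
  have hR2 : R ^ 2 = q + lam * s := Real.sq_sqrt hz.le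
  have hσ2 : σ * σ = 1 := by rcases hσ with h | h <;> rw [h] <;> norm_num
  have hσ1 : σ ≤ 1 ∧ -1 ≤ σ := by rcases hσ with h | h <;> rw [h] <;> norm_num
  have hkR : 0 < k * R := by positivity
  have hbl := (abs_le.1 hb).1
  have hbu := (abs_le.1 hb).2
  have hqR : q / R ≤ R := by
    rw [div_le_iff₀ hR0]; nlinarith [mul_pos (by linarith : 0 < lam) hs]
  have hqR0 : 0 ≤ q / R := by positivity
  have main : k * R * s ≤ s ^ 2 * (σ * adjKer n b₀ lam (σ * k) b s q) := by
    have e : s ^ 2 * (σ * adjKer n b₀ lam (σ * k) b s q)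
        = σ * ((b - b₀) * (n * s / 2 - b₀ * q / 4))
          + k * R * (3 * b₀ * q + b * (lam * s / 2 - q)) + σ * (9 * k ^ 2 * R ^ 2 * q)
          - k * (3 * n * R * s + 3 * (q / R) * s) := by
      have e1 : R ^ 3 = R * (q + lam * s) := by rw [← hR2]; ring
      simp only [adjKer, ← hRdef]
      rw [e1]
      have e2 : σ ^ 2 = 1 := by rw [sq, hσ2]
      have e3 : σ ^ 3 = σ := by rw [pow_succ, e2, one_mul]
      field_simp
      ring_nf
      rw [e2, e3]
      ring
    rw [e]
    have hX : |σ * ((b - b₀) * (n * s / 2 - b₀ * q / 4))| ≤ k * R * (n * s / 2 + b₀ * q / 4) := by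
      rw [abs_mul, abs_mul]
      have h1 : |σ| = 1 := by rcases hσ with h | h <;> rw [h] <;> norm_num
      rw [h1, one_mul]
      gcongr
      rw [abs_le]
      have : 0 ≤ n * s / 2 := by positivity
      have : 0 ≤ b₀ * q / 4 := by positivity
      constructor <;> linarith
    have hX' := (abs_le.1 hX).1
    have hY : -(9 * k ^ 2 * R ^ 2 * q) ≤ σ * (9 * k ^ 2 * R ^ 2 * q) := by
      have : 0 ≤ 9 * k ^ 2 * R ^ 2 * q := by positivity
      nlinarith
    have hY2 : 9 * k ^ 2 * R ^ 2 * q ≤ k * R * (b₀ / 2 * q) := by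
      have := mul_le_mul_of_nonneg_left hR (by positivity : 0 ≤ k * R * q)
      linarith
    have hW : k * R * (3 * b₀ * q - 2 * b₀ * q + b₀ / 2 * (lam * s / 2))
        ≤ k * R * (3 * b₀ * q + b * (lam * s / 2 - q)) := by
      refine mul_le_mul_of_nonneg_left ?_ hkR.le
      have h1 : b₀ / 2 * (lam * s / 2) ≤ b * (lam * s / 2) := by
        have : 0 ≤ lam * s / 2 := by positivity
        gcongr
        linarith
      have h2 : b * q ≤ 2 * b₀ * q := by
        gcongr
        linarith
      linarith
    have hV : k * (3 * n * R * s + 3 * (q / R) * s) ≤ k * R * (3 * n * s + 3 * s) := by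
      have : 3 * (q / R) * s ≤ 3 * R * s := by gcongr
      have := mul_le_mul_of_nonneg_left this (by linarith : 0 ≤ k)
      linarith
    have hU : k * R * s ≤ k * R * (-(n * s / 2 + b₀ * q / 4)
        + (3 * b₀ * q - 2 * b₀ * q + b₀ / 2 * (lam * s / 2)) - b₀ / 2 * q
        - (3 * n * s + 3 * s)) := by
      refine mul_le_mul_of_nonneg_left ?_ hkR.le
      have := mul_le_mul_of_nonneg_right hlam' hs.le
      have : 0 ≤ b₀ * q := by positivity
      linarith
    linarith
  have hRs : 2 * s ≤ k * R := by
    have : (2 * s) ^ 2 ≤ R ^ 2 := by rw [hR2]; nlinarith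
    have : 2 * s ≤ R := by
      rw [sq_le_sq₀ (by positivity) hR0.le] at this; exact this
    nlinarith
  have : s ^ 2 * 2 ≤ s ^ 2 * (σ * adjKer n b₀ lam (σ * k) b s q) := by
    refine le_trans ?_ main
    nlinarith
  exact le_of_mul_le_mul_left this (by positivity)

/-- The test functions: cut-offs in time and space times a function of the kernel. -/
def kerTest {N : ℕ} (ς xp : ℝ) (yp : Euc N) (b₀ lam kap : ℝ) (T Z f : ℝ → ℝ) :
    ℝ × Euc N → ℝ :=
  radialY yp fun x q => T (ς * (x - xp)) * Z q *
    f (Real.exp (logKer ((N - 1 : ℕ) : ℝ) b₀ lam kap (ς * (x - xp)) q))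

section kerTest

variable {N : ℕ} {ς xp : ℝ} {yp : Euc N} {b₀ lam kap : ℝ} {T Z f : ℝ → ℝ}

lemma kerTest_eventuallyEq_zero {ε : ℝ} (hε : 0 < ε) (hT0 : ∀ s ≤ ε, T s = 0) {p : ℝ × Euc N}
    (hs : ς * (p.1 - xp) ≤ 0) : kerTest ς xp yp b₀ lam kap T Z f =ᶠ[𝓝 p] 0 := by
  have : ∀ᶠ z : ℝ × Euc N in 𝓝 p, ς * (z.1 - xp) < ε :=
    (by fun_prop : Continuous fun z : ℝ × Euc N => ς * (z.1 - xp)).continuousAt.eventually_lt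
      continuousAt_const (hs.trans_lt hε)
  filter_upwards [this] with z hz
  simp [kerTest, radialY, hT0 _ hz.le]

lemma contDiffAt_kerTest (hlam : 0 < lam) (hT : ContDiff ℝ (⊤ : ℕ∞) T)
    (hZ : ContDiff ℝ (⊤ : ℕ∞) Z) (hf : ContDiff ℝ (⊤ : ℕ∞) f) {p : ℝ × Euc N}
    (hs : 0 < ς * (p.1 - xp)) :
    ContDiffAt ℝ (⊤ : ℕ∞) (kerTest ς xp yp b₀ lam kap T Z f) p := by
  refine contDiffAt_radialY ?_
  have h1 : ContDiff ℝ (⊤ : ℕ∞) fun z : ℝ × ℝ => (ς * (z.1 - xp), z.2) := by fun_prop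
  have h2 : ContDiffAt ℝ (⊤ : ℕ∞) (fun z : ℝ × ℝ =>
      logKer ((N - 1 : ℕ) : ℝ) b₀ lam kap (ς * (z.1 - xp)) z.2) (p.1, ‖p.2 - yp‖ ^ 2) :=
    ContDiffAt.comp (g := fun z : ℝ × ℝ => logKer ((N - 1 : ℕ) : ℝ) b₀ lam kap z.1 z.2)
      (p.1, ‖p.2 - yp‖ ^ 2) (contDiffAt_logKer hs (by positivity)) h1.contDiffAt
  refine ContDiffAt.mul (ContDiffAt.mul ?_ ?_) ?_
  · exact hT.contDiffAt.comp (p.1, ‖p.2 - yp‖ ^ 2)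
      (by fun_prop : ContDiff ℝ (⊤ : ℕ∞) fun z : ℝ × ℝ => ς * (z.1 - xp)).contDiffAt
  · exact hZ.contDiffAt.comp (p.1, ‖p.2 - yp‖ ^ 2) contDiffAt_snd
  · exact hf.contDiffAt.comp (p.1, ‖p.2 - yp‖ ^ 2) h2.exp

lemma contDiff_kerTest (hlam : 0 < lam) (hT : ContDiff ℝ (⊤ : ℕ∞) T)
    (hZ : ContDiff ℝ (⊤ : ℕ∞) Z) (hf : ContDiff ℝ (⊤ : ℕ∞) f)
    {ε : ℝ} (hε : 0 < ε) (hT0 : ∀ s ≤ ε, T s = 0) :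
    ContDiff ℝ (⊤ : ℕ∞) (kerTest ς xp yp b₀ lam kap T Z f) := by
  refine contDiff_iff_contDiffAt.2 fun p => ?_
  rcases le_or_gt (ς * (p.1 - xp)) 0 with hs | hs
  · exact contDiffAt_const.congr_of_eventuallyEq (kerTest_eventuallyEq_zero hε hT0 hs)
  · exact contDiffAt_kerTest hlam hT hZ hf hs

lemma adj_kerTest_of_nonpos {ε : ℝ} (hε : 0 < ε) (hT0 : ∀ s ≤ ε, T s = 0) {p : ℝ × Euc N}
    (hs : ς * (p.1 - xp) ≤ 0) (a : ℝ) :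
    lapY (kerTest ς xp yp b₀ lam kap T Z f) p
      - a * dX (kerTest ς xp yp b₀ lam kap T Z f) p = 0 := by
  have h := kerTest_eventuallyEq_zero (b₀ := b₀) (lam := lam) (kap := kap) (Z := Z) (f := f)
    (yp := yp) hε hT0 hs
  have h1 : dX (kerTest ς xp yp b₀ lam kap T Z f) p = 0 := by
    rw [dX, h.fderiv_eq]; simp
  have h2 : lapY (kerTest ς xp yp b₀ lam kap T Z f) p = 0 := by
    refine Finset.sum_eq_zero fun i _ => ?_
    have : (fun q => fderiv ℝ (kerTest ς xp yp b₀ lam kap T Z f) q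
        ((0 : ℝ), EuclideanSpace.single i (1 : ℝ))) =ᶠ[𝓝 p] fun _ => 0 := by
      filter_upwards [h.eventuallyEq_nhds] with z hz
      rw [hz.fderiv_eq]; simp
    rw [this.fderiv_eq]; simp
  rw [h1, h2]; simp

lemma adj_kerTest (hlam : 0 < lam) (hT : ContDiff ℝ (⊤ : ℕ∞) T)
    (hZ : ContDiff ℝ (⊤ : ℕ∞) Z) (hf : ContDiff ℝ (⊤ : ℕ∞) f) {p : ℝ × Euc N} {s q G hq : ℝ}
    (hs : 0 < s) (hsp : s = ς * (p.1 - xp)) (hqp : q = ‖p.2 - yp‖ ^ 2)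
    (hG : G = Real.exp (logKer ((N - 1 : ℕ) : ℝ) b₀ lam kap s q))
    (hhq : hq = -b₀ / (4 * s) - 3 / 2 * kap * √(q + lam * s) / s) (a : ℝ) :
    lapY (kerTest ς xp yp b₀ lam kap T Z f) p - a * dX (kerTest ς xp yp b₀ lam kap T Z f) p
      = T s * Z q * (deriv f G * G * adjKer ((N - 1 : ℕ) : ℝ) b₀ lam kap (ς * a) s q
          + 4 * q * deriv (deriv f) G * hq ^ 2 * G ^ 2)
        + T s * (2 * ((N - 1 : ℕ) : ℝ) * deriv Z q * f G
          + 4 * q * (deriv (deriv Z) q * f G + 2 * deriv Z q * deriv f G * hq * G))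
        - ς * a * deriv T s * Z q * f G := by
  have hq0 : 0 ≤ q := by rw [hqp]; positivity
  have dT : ∀ t, HasDerivAt T (deriv T t) t := fun t =>
    (hT.differentiable (by simp) t).hasDerivAt
  have dZ : ∀ t, HasDerivAt Z (deriv Z t) t := fun t =>
    (hZ.differentiable (by simp) t).hasDerivAt
  have df : ∀ t, HasDerivAt f (deriv f t) t := fun t =>
    (hf.differentiable (by simp) t).hasDerivAt
  have dZ' : ∀ t, HasDerivAt (deriv Z) (deriv (deriv Z) t) t := fun t =>
    ((contDiff_infty_iff_deriv.1 hZ).2.differentiable (by simp) t).hasDerivAt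
  have df' : ∀ t, HasDerivAt (deriv f) (deriv (deriv f) t) t := fun t =>
    ((contDiff_infty_iff_deriv.1 hf).2.differentiable (by simp) t).hasDerivAt
  have hcd : ContDiffAt ℝ (⊤ : ℕ∞) (kerTest ς xp yp b₀ lam kap T Z f) p :=
    contDiffAt_kerTest hlam hT hZ hf (hsp ▸ hs)
  have hz : 0 < q + lam * s := by positivity
  set n : ℝ := ((N - 1 : ℕ) : ℝ) with hn
  set ht := -n / (2 * s) + b₀ * q / (4 * s ^ 2)
        - kap * (3 / 2 * lam * √(q + lam * s) / s - √(q + lam * s) ^ 3 / s ^ 2) with hht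
  set hqq := -(3 / 4 * kap / (√(q + lam * s) * s)) with hhqq
  have e1 : dX (kerTest ς xp yp b₀ lam kap T Z f) p
      = ς * (deriv T s * Z q * f G + T s * Z q * (deriv f G * (G * ht))) := by
    refine dX_radialY (hcd.differentiableAt (by simp)) ?_
    have d1 : HasDerivAt (fun x => ς * (x - xp)) ς p.1 := by
      have := ((hasDerivAt_id p.1).sub_const xp).const_mul ς
      exact this.congr_deriv (by simp)
    have d2 : HasDerivAt (fun s => T s * Z q * f (Real.exp (logKer n b₀ lam kap s q)))
        (deriv T s * Z q * f G + T s * Z q * (deriv f G * (G * ht))) s := by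
      have := ((dT s).mul_const (Z q)).mul ((df _).comp s (hasDerivAt_logKer_time (n := n)
        (b₀ := b₀) (kap := kap) hs hz).exp)
      refine this.congr_deriv ?_
      simp only [Function.comp, ← hG, hht]
    rw [hsp] at d2
    have := d2.comp p.1 d1
    rw [← hsp] at this
    rw [← hqp]
    exact this.congr_deriv (by ring)
  have e2 := lapY_radialY (c := yp) (p := p) (Ψ := fun x q => T (ς * (x - xp)) * Z q *
    f (Real.exp (logKer n b₀ lam kap (ς * (x - xp)) q))) (contDiffAt_infty.1 hcd 2)
    (F' := fun q => T s * (deriv Z q * f (Real.exp (logKer n b₀ lam kap s q))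
      + Z q * (deriv f (Real.exp (logKer n b₀ lam kap s q)) * (Real.exp (logKer n b₀ lam kap s q)
        * (-b₀ / (4 * s) - 3 / 2 * kap * √(q + lam * s) / s)))))
    (F'' := T s * ((deriv (deriv Z) q * f G + deriv Z q * (deriv f G * (G * hq)))
      + (deriv Z q * (deriv f G * (G * hq)) + Z q * (deriv (deriv f) G * (G * hq) * (G * hq)
        + deriv f G * (G * hq * hq + G * hqq)))))
    (by
      rw [← hqp, ← hsp]
      have : ∀ᶠ r in 𝓝 q, 0 < r + lam * s :=
        continuousAt_const.eventually_lt (by fun_prop) hz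
      filter_upwards [this] with r hr
      have := ((dZ r).const_mul (T s)).mul ((df _).comp r (hasDerivAt_logKer_space (n := n)
        (b₀ := b₀) (kap := kap) hr).exp)
      refine this.congr_deriv ?_
      simp only [Function.comp]
      ring)
    (by
      rw [← hqp]
      have d1 := (hasDerivAt_logKer_space (n := n) (b₀ := b₀) (kap := kap) hz).exp
      have d2 := hasDerivAt_logKer_space_deriv (b₀ := b₀) (kap := kap) hz
      have d3 := (df _).comp q d1
      have d4 := (df' _).comp q d1
      refine ((((dZ' q).mul d3).add ((dZ q).mul (d4.mul (d1.mul d2)))).const_mul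
        (T s)).congr_deriv ?_
      simp only [Function.comp, Pi.mul_apply, ← hG, ← hhq, hhqq])
  simp only [← hqp, ← hG, ← hhq, ← hn] at e2
  rw [e1, kerTest, ← hn, e2, adjKer, ← hhq, ← hhqq, ← hht]
  ring

lemma tsupport_kerTest_subset (hς : ς = 1 ∨ ς = -1) {s₁ r : ℝ} (hr : 0 < r)
    (hT0 : ∀ s ≤ 0, T s = 0) (hT1 : ∀ s, s₁ ≤ s → T s = 0) (hZ1 : ∀ q, r ^ 2 ≤ q → Z q = 0)
    : tsupport (kerTest ς xp yp b₀ lam kap T Z f)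
      ⊆ Icc (xp - s₁) (xp + s₁) ×ˢ closedBall yp r := by
  refine closure_minimal (fun p hp => ?_) (isClosed_Icc.prod isClosed_closedBall)
  have h1 := left_ne_zero_of_mul (left_ne_zero_of_mul (show _ * _ * _ ≠ (0 : ℝ) from hp))
  have h2 := right_ne_zero_of_mul (left_ne_zero_of_mul (show _ * _ * _ ≠ (0 : ℝ) from hp))
  have h3 : 0 < ς * (p.1 - xp) := lt_of_not_ge fun h => h1 (hT0 _ h)
  have h4 : ς * (p.1 - xp) < s₁ := lt_of_not_ge fun h => h1 (hT1 _ h)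
  have h5 : ‖p.2 - yp‖ ^ 2 < r ^ 2 := lt_of_not_ge fun h => h2 (hZ1 _ h)
  refine ⟨?_, ?_⟩
  · rcases hς with h | h <;> rw [h] at h3 h4 <;> constructor <;> linarith
  · rw [mem_closedBall, dist_eq_norm]
    exact (lt_of_pow_lt_pow_left₀ 2 hr.le h5).le

end kerTest

/-- Smooth decreasing cut-offs equal to `1` on `(-∞, a]` and to `0` on `[b, ∞)`. -/
structure IsCutoff (a b : ℝ) (Z : ℝ → ℝ) : Prop where
  contDiff : ContDiff ℝ (⊤ : ℕ∞) Z
  nonneg : ∀ s, 0 ≤ Z s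
  le_one : ∀ s, Z s ≤ 1
  eq_one : ∀ s ≤ a, Z s = 1
  eq_zero : ∀ s, b ≤ s → Z s = 0
  deriv_nonpos : ∀ s, deriv Z s ≤ 0

lemma exists_isCutoff {a b : ℝ} (hab : a < b) : ∃ Z, IsCutoff a b Z := by
  have hba : 0 < b - a := sub_pos.2 hab
  have hc : ContDiff ℝ (⊤ : ℕ∞) fun s : ℝ => (b - s) / (b - a) := by fun_prop
  refine ⟨fun s => Real.smoothTransition ((b - s) / (b - a)), ?_, ?_, ?_, ?_, ?_, ?_⟩
  · exact Real.smoothTransition.contDiff.comp hc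
  · exact fun s => Real.smoothTransition.nonneg _
  · exact fun s => Real.smoothTransition.le_one _
  · intro s hs
    refine Real.smoothTransition.one_of_one_le ?_
    rw [le_div_iff₀ hba]; linarith
  · intro s hs
    refine Real.smoothTransition.zero_of_nonpos ?_
    exact div_nonpos_of_nonpos_of_nonneg (by linarith) hba.le
  · intro s
    refine Antitone.deriv_nonpos ?_
    intro x y hxy
    refine Real.smoothTransition.monotone ?_
    gcongr

namespace IsCutoff

variable {a b : ℝ} {Z : ℝ → ℝ}

lemma hasDerivAt (h : IsCutoff a b Z) (s : ℝ) : HasDerivAt Z (deriv Z s) s :=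
  (h.contDiff.differentiable (by simp) s).hasDerivAt

lemma contDiff_deriv (h : IsCutoff a b Z) : ContDiff ℝ (⊤ : ℕ∞) (deriv Z) :=
  (contDiff_infty_iff_deriv.1 h.contDiff).2

lemma deriv_eq_zero (h : IsCutoff a b Z) {s : ℝ} (hs : s < a ∨ b < s) : deriv Z s = 0 := by
  rcases hs with hs | hs
  · have : Z =ᶠ[𝓝 s] fun _ => 1 := by
      filter_upwards [Iio_mem_nhds hs] with t ht using h.eq_one t (le_of_lt ht)
    rw [this.deriv_eq]; simp
  · have : Z =ᶠ[𝓝 s] fun _ => 0 := by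
      filter_upwards [Ioi_mem_nhds hs] with t ht using h.eq_zero t (le_of_lt ht)
    rw [this.deriv_eq]; simp

lemma deriv_deriv_eq_zero (h : IsCutoff a b Z) {s : ℝ} (hs : s < a ∨ b < s) :
    deriv (deriv Z) s = 0 := by
  have : deriv Z =ᶠ[𝓝 s] fun _ => 0 := by
    rcases hs with hs | hs
    · filter_upwards [Iio_mem_nhds hs] with t ht using h.deriv_eq_zero (.inl ht)
    · filter_upwards [Ioi_mem_nhds hs] with t ht using h.deriv_eq_zero (.inr ht)
  rw [this.deriv_eq]; simp

lemma hasCompactSupport_deriv (h : IsCutoff a b Z) : HasCompactSupport (deriv Z) := by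
  refine HasCompactSupport.of_support_subset_isCompact (isCompact_Icc (a := a) (b := b)) ?_
  intro s hs
  by_contra hc
  rw [mem_Icc, not_and_or, not_le, not_le] at hc
  exact hs (h.deriv_eq_zero hc)

lemma exists_bound (h : IsCutoff a b Z) :
    ∃ K, 0 ≤ K ∧ ∀ s, |deriv Z s| ≤ K ∧ |deriv (deriv Z) s| ≤ K := by
  obtain ⟨K₁, h₁⟩ := h.hasCompactSupport_deriv.exists_bound_of_continuous
    h.contDiff_deriv.continuous
  obtain ⟨K₂, h₂⟩ := h.hasCompactSupport_deriv.deriv.exists_bound_of_continuous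
    (contDiff_infty_iff_deriv.1 h.contDiff_deriv).2.continuous
  exact ⟨max K₁ K₂, (norm_nonneg _).trans ((h₁ 0).trans (le_max_left _ _)),
    fun s => ⟨(h₁ s).trans (le_max_left _ _), (h₂ s).trans (le_max_right _ _)⟩⟩

lemma integrable_deriv (h : IsCutoff a b Z) : Integrable (deriv Z) :=
  h.contDiff_deriv.continuous.integrable_of_hasCompactSupport h.hasCompactSupport_deriv

lemma integral_deriv (h : IsCutoff a b Z) : ∫ s, deriv Z s = -1 := by
  rw [integral_of_hasDerivAt_of_tendsto (m := 1) (n := 0) h.hasDerivAt h.integrable_deriv]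
  · norm_num
  · refine tendsto_const_nhds.congr' ?_
    filter_upwards [eventually_le_atBot a] with s hs using (h.eq_one s hs).symm
  · refine tendsto_const_nhds.congr' ?_
    filter_upwards [eventually_ge_atTop b] with s hs using (h.eq_zero s hs).symm

lemma integral_neg_deriv_comp (h : IsCutoff a b Z) {ς : ℝ} (hς : ς = 1 ∨ ς = -1) (xp : ℝ) :
    ∫ x, -deriv Z (ς * (x - xp)) = 1 := by
  rw [integral_neg, integral_sub_right_eq_self (fun x => deriv Z (ς * x)) xp]
  rcases hς with rfl | rfl
  · simp [h.integral_deriv]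
  · simp only [neg_mul, one_mul]
    rw [integral_neg_eq_self (fun x => deriv Z x), h.integral_deriv]
    norm_num

lemma integrable_neg_deriv_comp (h : IsCutoff a b Z) {ς : ℝ} (hς : ς = 1 ∨ ς = -1) (xp : ℝ) :
    Integrable fun x => -deriv Z (ς * (x - xp)) :=
  integrable_of_integral_eq_one (h.integral_neg_deriv_comp hς xp)

end IsCutoff

/-- Testing the equation with a nonnegative function which is, up to `A` and `D`, a supersolution
(`σ = 1`) or a subsolution (`σ = -1`) of the adjoint equation. -/
lemma NonnegSolution.integral_le_of_adj_le {N : ℕ} {β : Euc N → ℝ} {γ u : ℝ × Euc N → ℝ} {M : ℝ}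
    (hβ : CoeffBound β M) (hu : NonnegSolution β γ u) {σ : ℝ} (hσ : σ = 1 ∨ σ = -1)
    {ψ A D : ℝ × Euc N → ℝ} (hψ : ContDiff ℝ (⊤ : ℕ∞) ψ) (hψc : HasCompactSupport ψ)
    (hψs : tsupport ψ ⊆ cylD N) (hψ0 : ∀ p, 0 ≤ ψ p)
    (hA : IntegrableOn (fun p => u p * A p) (cylD N))
    (hD : IntegrableOn (fun p => u p * D p) (cylD N))
    (h : ∀ p ∈ cylD N, σ * (lapY ψ p - β p.2 * dX ψ p) + ψ p ≤ A p - D p) :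
    ∫ p in cylD N, u p * D p ≤ ∫ p in cylD N, u p * A p := by
  have hmeasD := (isOpen_cylD N).measurableSet
  have hψ2 : ContDiff ℝ 2 ψ := contDiff_infty.1 hψ 2
  have hdXc := continuous_dX (hψ2.of_le (by norm_num) : ContDiff ℝ 1 ψ)
  have hlapc := continuous_lapY hψ2
  obtain ⟨C₁, hC₁⟩ := hψc.lapY.exists_bound_of_continuous hlapc
  obtain ⟨C₂, hC₂⟩ := hψc.dX.exists_bound_of_continuous hdXc
  obtain ⟨C₃, hC₃⟩ := hψc.exists_bound_of_continuous hψ.continuous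
  have hintg : IntegrableOn (fun p => u p * (lapY ψ p - β p.2 * dX ψ p + γ p * ψ p)) (cylD N) := by
    refine hu.integrableOn_mul (C := C₁ + M * C₂ + 1 * C₃) ?_ ?_
    · exact (hlapc.aestronglyMeasurable.sub
        (hβ.aestronglyMeasurable.mul hdXc.aestronglyMeasurable)).add
        (hu.meas.aestronglyMeasurable.mul hψ.continuous.aestronglyMeasurable)
    · filter_upwards [hu.abs_coeff, ae_restrict_mem hmeasD] with p hp hpD
      refine (abs_add_le _ _).trans (add_le_add ((abs_sub _ _).trans (add_le_add (hC₁ p) ?_)) ?_)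
      · rw [abs_mul]
        have := hβ.abs_bound p.2 hpD.2
        have hM0 : 0 ≤ M := by linarith [hβ.one_le]
        gcongr
        exact hC₂ p
      · rw [abs_mul]
        gcongr
        exact hC₃ p
  have htest := hu.sol ψ hψ hψc hψs
  have key : ∫ p in cylD N, σ * (u p * (lapY ψ p - β p.2 * dX ψ p + γ p * ψ p))
      ≤ ∫ p in cylD N, (u p * A p - u p * D p) := by
    refine integral_mono_ae (hintg.const_mul σ) (hA.sub hD) ?_
    filter_upwards [hu.abs_coeff, ae_restrict_mem hmeasD] with p hp hpD
    have h1 := h p hpD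
    have h2 : σ * (γ p * ψ p) ≤ ψ p := by
      have h3 := abs_le.1 hp
      have h4 := hψ0 p
      rcases hσ with rfl | rfl <;> nlinarith
    have h3 : σ * (lapY ψ p - β p.2 * dX ψ p + γ p * ψ p) ≤ A p - D p := by linarith
    have h4 := mul_le_mul_of_nonneg_left h3 (hu.nonneg p hpD)
    linarith
  rw [integral_const_mul, htest, mul_zero, integral_sub hA hD] at key
  linarith

lemma exists_bound_exp_neg_div (n : ℝ) (hn : 0 ≤ n) {a : ℝ} (ha : 0 < a) :
    ∃ K, 0 < K ∧ ∀ s, 0 < s → Real.exp (-(n / 2) * Real.log s - a / s) * (1 + 1 / s) ≤ K := by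
  set c := min 1 (a / (n / 2 + 1)) with hc
  have hc0 : 0 < c := lt_min one_pos (by positivity)
  have hc1 : c ≤ 1 := min_le_left _ _
  have hca : c * (n / 2 + 1) ≤ a := by
    have := min_le_right 1 (a / (n / 2 + 1))
    rwa [← hc, le_div_iff₀ (by positivity)] at this
  refine ⟨Real.exp (n / 2 * (-1 - Real.log c)) / c, by positivity, fun s hs => ?_⟩
  have h1 : 1 + 1 / s ≤ Real.exp (c / s) / c := by
    rw [le_div_iff₀ hc0]
    have h2 : c / s + 1 ≤ Real.exp (c / s) := Real.add_one_le_exp _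
    have : (1 + 1 / s) * c = c + c / s := by ring
    linarith
  have h2 : -Real.log s ≤ c / s - 1 - Real.log c := by
    have := Real.log_le_sub_one_of_pos (div_pos hc0 hs)
    rw [Real.log_div hc0.ne' hs.ne'] at this
    linarith
  calc _ ≤ Real.exp (-(n / 2) * Real.log s - a / s) * (Real.exp (c / s) / c) := by gcongr
    _ = Real.exp (-(n / 2) * Real.log s - a / s + c / s) / c := by rw [Real.exp_add]; ring
    _ ≤ _ := by
      gcongr
      have h3 := mul_le_mul_of_nonneg_left h2 (by positivity : 0 ≤ n / 2)
      have h4 : c * (n / 2 + 1) / s ≤ a / s := by gcongr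
      have h5 : c * (n / 2 + 1) / s = n / 2 * (c / s) + c / s := by ring
      linarith

lemma abs_logKer_add_le {n b₀ lam kap s q : ℝ} (hs : 0 < s) (hq : 0 ≤ q) (hlam : 0 < lam)
    (hR : 18 * |kap| * √(q + lam * s) ≤ b₀) :
    |logKer n b₀ lam kap s q + n / 2 * Real.log s + b₀ * q / (4 * s)|
      ≤ b₀ / 18 * (q / s + lam) := by
  have hz : 0 < q + lam * s := by positivity
  set R := √(q + lam * s) with hRdef
  have hR0 : 0 < R := Real.sqrt_pos.2 hz
  have hR2 : R ^ 2 = q + lam * s := Real.sq_sqrt hz.le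
  have e : logKer n b₀ lam kap s q + n / 2 * Real.log s + b₀ * q / (4 * s)
      = -(kap * R * (q / s + lam)) := by
    have : R ^ 3 = R * (q + lam * s) := by rw [← hR2]; ring
    rw [logKer, ← hRdef, this]
    field_simp
    ring
  rw [e, abs_neg, abs_mul, abs_mul, abs_of_pos hR0, abs_of_pos (by positivity : 0 < q / s + lam)]
  gcongr
  linarith

lemma logKer_le_of_nonneg {n b₀ lam kap s q : ℝ} (hs : 0 < s) (hkap : 0 ≤ kap) :
    logKer n b₀ lam kap s q ≤ -(n / 2) * Real.log s - b₀ * q / (4 * s) := by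
  have : 0 ≤ kap * √(q + lam * s) ^ 3 / s := by positivity
  rw [logKer]; linarith

lemma le_logKer_of_nonpos {n b₀ lam kap s q : ℝ} (hs : 0 < s) (hkap : kap ≤ 0) :
    -(n / 2) * Real.log s - b₀ * q / (4 * s) ≤ logKer n b₀ lam kap s q := by
  have : 0 ≤ -kap * √(q + lam * s) ^ 3 / s :=
    div_nonneg (mul_nonneg (by linarith) (by positivity)) hs.le
  rw [neg_mul, neg_div] at this
  rw [logKer]; linarith

/-- The cylinder of size `τ` on the past side (`ς (x - x₀) ≥ 0`) of the point `(x₀, y₀)`. -/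
def window {N : ℕ} (ς x₀ : ℝ) (y₀ : Euc N) (τ : ℝ) : Set (ℝ × Euc N) :=
  {p | ς * (p.1 - x₀) ∈ Icc 0 τ ∧ ‖p.2 - y₀‖ ^ 2 ≤ τ}

lemma measurableSet_window {N : ℕ} (ς x₀ : ℝ) (y₀ : Euc N) (τ : ℝ) :
    MeasurableSet (window ς x₀ y₀ τ) :=
  ((isClosed_Icc.preimage (by fun_prop : Continuous fun p : ℝ × Euc N => ς * (p.1 - x₀))).inter
    (isClosed_Iic.preimage
      (by fun_prop : Continuous fun p : ℝ × Euc N => ‖p.2 - y₀‖ ^ 2))).measurableSet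

/-- Admissible scales: `lam` is the parameter of the kernel, `ρ` bounds the size of its support. -/
structure Scale (N : ℕ) (d M lam ρ : ℝ) : Prop where
  d_pos : 0 < d
  d_le : d ≤ M
  one_le : 1 ≤ M
  four_le : 4 ≤ lam
  lam_ge : ((N - 1 : ℕ) : ℝ) / 2 + 3 * ((N - 1 : ℕ) : ℝ) + 4 ≤ d / 2 * lam / 4
  rho_pos : 0 < ρ
  rho_le : 36 * M * ρ ≤ d

/-- The basic inequality for the perturbed kernels, in the form used for the test functions. -/
lemma Scale.adjKer_bound {N : ℕ} {d M lam ρ : ℝ} (hS : Scale N d M lam ρ) {β : Euc N → ℝ}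
    (hβ : CoeffBound β M) {ς : ℝ} (hς : ς = 1 ∨ ς = -1) {yp y : Euc N} (hyp : yp ∈ ball 0 3)
    (hy : y ∈ ball 0 3) (hd : d / 2 ≤ ς * β yp) {s : ℝ} (hs : 0 < s)
    (hs1 : s ≤ 1) (hR : ‖y - yp‖ ^ 2 + lam * s ≤ ρ ^ 2) {σ : ℝ} (hσ : σ = 1 ∨ σ = -1) :
    18 * M * √(‖y - yp‖ ^ 2 + lam * s) ≤ ς * β yp ∧ ς * β yp ≤ M ∧ d / 4 ≤ ς * β y ∧ ς * β y ≤ M ∧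
      2 ≤ σ * adjKer ((N - 1 : ℕ) : ℝ) (ς * β yp) lam (σ * M) (ς * β y) s (‖y - yp‖ ^ 2) := by
  have hM := hS.one_le
  have hlam := hS.four_le
  have hz : 0 ≤ ‖y - yp‖ ^ 2 + lam * s := by positivity
  have hRρ : √(‖y - yp‖ ^ 2 + lam * s) ≤ ρ := Real.sqrt_le_iff.2 ⟨hS.rho_pos.le, hR⟩
  have h1 : 18 * M * √(‖y - yp‖ ^ 2 + lam * s) ≤ ς * β yp := by
    have : M * √(‖y - yp‖ ^ 2 + lam * s) ≤ M * ρ := by gcongr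
    linarith [hS.rho_le]
  have hle : ‖y - yp‖ ≤ √(‖y - yp‖ ^ 2 + lam * s) := by
    refine Real.le_sqrt_of_sq_le ?_
    have : 0 ≤ lam * s := by positivity
    linarith
  have habs : |ς| = 1 := by rcases hς with h | h <;> rw [h] <;> norm_num
  have h2 : |ς * β y - ς * β yp| ≤ M * √(‖y - yp‖ ^ 2 + lam * s) := by
    rw [← mul_sub, abs_mul, habs, one_mul]
    exact (hβ.lip y hy yp hyp).trans (by gcongr)
  have hbd : ∀ z ∈ ball (0 : Euc N) 3, ς * β z ≤ M := fun z hz => by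
    refine (le_abs_self _).trans ?_
    rw [abs_mul, habs, one_mul]
    exact hβ.abs_bound z hz
  have hdp := hS.d_pos
  refine ⟨h1, hbd yp hyp, ?_, hbd y hy, ?_⟩
  · linarith [(abs_le.1 h2).1]
  · refine two_le_mul_adjKer (Nat.cast_nonneg _) hs hs1 (by positivity) hM hσ (by linarith) h2
      (by linarith) hlam (hS.lam_ge.trans ?_)
    gcongr

set_option maxHeartbeats 1000000 in
/-- The test function behind the local upper bound. -/
lemma Scale.exists_adj_upper_bound {N : ℕ} {d M lam ρ τ : ℝ} (hS : Scale N d M lam ρ)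
    (hτ : 0 < τ) (hτ1 : τ ≤ 1) (hτρ : τ + lam * τ ≤ ρ ^ 2) {θ Z : ℝ → ℝ}
    (hθ : IsCutoff (τ / 2) τ θ) (hZ : IsCutoff (τ / 4) τ Z) :
    ∃ C, 0 ≤ C ∧ ∀ {β : Euc N → ℝ}, CoeffBound β M → ∀ {ς : ℝ}, (ς = 1 ∨ ς = -1) →
      ∀ {xp : ℝ} {yp : Euc N}, yp ∈ ball 0 1 → d ≤ ς * β yp → ∀ {ε : ℝ}, 0 < ε → ε ≤ τ / 8 →
      ∀ {χ : ℝ → ℝ}, IsCutoff ε (2 * ε) χ → ∀ p ∈ cylD N,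
      lapY (kerTest ς xp yp (ς * β yp) lam (-1 * M) (fun s => (1 - χ s) * θ s) Z id) p
        - β p.2 * dX (kerTest ς xp yp (ς * β yp) lam (-1 * M) (fun s => (1 - χ s) * θ s) Z id) p
        + kerTest ς xp yp (ς * β yp) lam (-1 * M) (fun s => (1 - χ s) * θ s) Z id p
      ≤ (window ς xp yp τ).indicator (fun _ => C) p
        - d / 4 * Real.exp (-(((N - 1 : ℕ) : ℝ) / 2) * Real.log (2 * ε) - M / 4)
          * (-deriv χ (ς * (p.1 - xp)) * (closedBall yp √ε).indicator (fun _ => 1) p.2) := by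
  set n : ℝ := ((N - 1 : ℕ) : ℝ) with hn
  have hn0 : 0 ≤ n := Nat.cast_nonneg _
  have hd := hS.d_pos
  have hM := hS.one_le
  have hlam := hS.four_le
  obtain ⟨KZ, hKZ0, hKZ⟩ := hZ.exists_bound
  obtain ⟨Kθ, hKθ0, hKθ⟩ := hθ.exists_bound
  obtain ⟨K₀, hK₀, hK₀'⟩ := exists_bound_exp_neg_div n hn0 (a := d * τ / 32) (by positivity)
  set E := Real.exp (M * lam / 18) with hE
  set C₁ := KZ * (2 * n + 4 * τ + 16 * τ * M) * (E * K₀) with hC₁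
  set C₂ := M * Kθ * (E * Real.exp (-(n / 2) * Real.log (τ / 2))) with hC₂
  have hC₁0 : 0 ≤ C₁ := by positivity
  have hC₂0 : 0 ≤ C₂ := by positivity
  refine ⟨C₁ + C₂, by positivity, ?_⟩
  intro β hβ ς hς xp yp hyp hb ε hε hετ χ hχ p hp
  have hT : ContDiff ℝ (⊤ : ℕ∞) fun s => (1 - χ s) * θ s :=
    (contDiff_const.sub hχ.contDiff).mul hθ.contDiff
  have hT0 : ∀ s ≤ ε, (1 - χ s) * θ s = 0 := fun s hs => by rw [hχ.eq_one s hs]; ring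
  have hyp3 : yp ∈ ball (0 : Euc N) 3 := ball_subset_ball (by norm_num) hyp
  have hind : 0 ≤ (window ς xp yp τ).indicator (fun _ => C₁ + C₂) p :=
    indicator_nonneg (fun _ _ => by positivity) _
  rcases le_or_gt (ς * (p.1 - xp)) 0 with hs | hs
  · rw [adj_kerTest_of_nonpos hε hT0 hs, hχ.deriv_eq_zero (.inl (by linarith)),
      (kerTest_eventuallyEq_zero hε hT0 hs).eq_of_nhds]
    simpa using hind
  set s := ς * (p.1 - xp) with hsdef
  set q := ‖p.2 - yp‖ ^ 2 with hqdef
  set b₀ := ς * β yp with hb₀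
  set G := Real.exp (logKer n b₀ lam (-1 * M) s q) with hGdef
  set hq := -b₀ / (4 * s) - 3 / 2 * (-1 * M) * √(q + lam * s) / s with hhq
  have hG0 : 0 < G := Real.exp_pos _
  have hq0 : 0 ≤ q := by positivity
  have hdT : deriv (fun s => (1 - χ s) * θ s) s = -deriv χ s * θ s + (1 - χ s) * deriv θ s :=
    (((hχ.hasDerivAt s).const_sub 1).mul (hθ.hasDerivAt s)).deriv
  rw [adj_kerTest (by linarith) hT hZ.contDiff contDiff_id hs hsdef hqdef hGdef hhq, hdT]
  have hval : kerTest ς xp yp b₀ lam (-1 * M) (fun s => (1 - χ s) * θ s) Z id p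
      = (1 - χ s) * θ s * Z q * G := rfl
  rw [hval]
  have hd1 : deriv (id : ℝ → ℝ) = fun _ => 1 := by funext x; simp
  simp only [hd1, deriv_const, id, mul_zero, zero_mul, one_mul, add_zero, mul_one]
  have hχ0 := hχ.nonneg s
  have hχ1 := hχ.le_one s
  have hθ0 := hθ.nonneg s
  have hθ1 := hθ.le_one s
  have hZ0 := hZ.nonneg q
  have hZ1 := hZ.le_one q
  by_cases hout : τ < s ∨ τ < q
  · have hD : -deriv χ s * (closedBall yp √ε).indicator (fun _ => 1) p.2 = 0 := by
      rcases hout with h | h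
      · rw [hχ.deriv_eq_zero (.inr (by linarith))]; simp
      · rw [indicator_of_notMem]
        · simp
        · intro hc
          rw [mem_closedBall, dist_eq_norm] at hc
          have : q ≤ √ε ^ 2 := by rw [hqdef]; gcongr
          rw [Real.sq_sqrt hε.le] at this
          linarith
    rw [hD, mul_zero, sub_zero]
    refine le_trans (le_of_eq ?_) hind
    rcases hout with h | h
    · rw [hθ.deriv_eq_zero (.inr h), hθ.eq_zero s h.le]; ring
    · rw [hZ.deriv_eq_zero (.inr h), hZ.deriv_deriv_eq_zero (.inr h), hZ.eq_zero q h.le]; ring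
  push Not at hout
  obtain ⟨hsτ, hqτ⟩ := hout
  have hmem : p ∈ window ς xp yp τ := ⟨⟨hs.le, hsτ⟩, hqτ⟩
  rw [indicator_of_mem hmem]
  have hRρ : q + lam * s ≤ ρ ^ 2 := by
    have : lam * s ≤ lam * τ := by gcongr
    linarith
  obtain ⟨hR, hb₀M, hbd, hbM, hP⟩ := hS.adjKer_bound hβ hς hyp3 hp.2 (by linarith) hs
    (by linarith) hRρ (σ := -1) (.inr rfl)
  rw [← hqdef, ← hn, ← hb₀] at hP
  rw [← hb₀] at hR hb₀M
  set P := adjKer n b₀ lam (-1 * M) (ς * β p.2) s q with hPdef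
  set b := ς * β p.2 with hbdef
  have hGup : G ≤ E * Real.exp (-(n / 2) * Real.log s - b₀ * q / (8 * s)) := by
    rw [hGdef, hE, ← Real.exp_add]
    gcongr
    have h1 := (abs_le.1 (abs_logKer_add_le (n := n) (b₀ := b₀) (kap := -1 * M) hs hq0
      (by linarith : 0 < lam) (by rw [neg_one_mul, abs_neg, abs_of_pos (by linarith)]; exact hR))).2
    have h2 : b₀ * lam ≤ M * lam := by gcongr
    have h3 : b₀ * q / (8 * s) = b₀ * q / s / 8 := by field_simp
    have h4 : b₀ * q / (4 * s) = b₀ * q / s / 4 := by field_simp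
    have h5 : b₀ / 18 * (q / s + lam) = b₀ * q / s / 18 + b₀ * lam / 18 := by ring
    have h6 : 0 ≤ b₀ * q / s := div_nonneg (mul_nonneg (by linarith) hq0) hs.le
    rw [h3]
    rw [h4, h5] at h1
    linarith
  have hGlow : Real.exp (-(n / 2) * Real.log s - b₀ * q / (4 * s)) ≤ G :=
    Real.exp_le_exp.2 (le_logKer_of_nonpos hs (by linarith))
  -- the bulk term
  have t1 : (1 - χ s) * θ s * Z q * (G * P) + (1 - χ s) * θ s * Z q * G ≤ 0 := by
    have h1 : 0 ≤ (1 - χ s) * θ s * Z q * G :=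
      mul_nonneg (mul_nonneg (mul_nonneg (by linarith) hθ0) hZ0) hG0.le
    have h2 : P + 1 ≤ 0 := by linarith
    have := mul_nonpos_of_nonneg_of_nonpos h1 h2
    linarith
  -- the spatial cut-off
  have t2 : (1 - χ s) * θ s * (2 * n * deriv Z q * G
      + 4 * q * (deriv (deriv Z) q * G + 2 * deriv Z q * hq * G)) ≤ C₁ := by
    rcases lt_or_ge q (τ / 4) with hq4 | hq4
    · rw [hZ.deriv_eq_zero (.inl hq4), hZ.deriv_deriv_eq_zero (.inl hq4)]
      simpa using hC₁0
    have hhqb : |hq| ≤ 2 * M / s := by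
      have hR1 : √(q + lam * s) * M * 18 ≤ M := by linarith
      have hR0 : 0 ≤ M * √(q + lam * s) := by positivity
      have : hq = (-b₀ / 4 + 3 / 2 * (M * √(q + lam * s))) / s := by
        rw [hhq]; field_simp; ring
      rw [this, abs_div, abs_of_pos hs]
      gcongr
      rw [abs_le]
      constructor <;> linarith
    have hX : |2 * n * deriv Z q * G + 4 * q * (deriv (deriv Z) q * G + 2 * deriv Z q * hq * G)|
        ≤ KZ * (2 * n + 4 * τ + 16 * τ * M) * (G * (1 + 1 / s)) := by
      have h1 := (hKZ q).1
      have h2 := (hKZ q).2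
      calc _ ≤ |2 * n * deriv Z q * G| + |4 * q * (deriv (deriv Z) q * G
            + 2 * deriv Z q * hq * G)| := abs_add_le _ _
        _ ≤ 2 * n * |deriv Z q| * G + 4 * q * (|deriv (deriv Z) q| * G
            + 2 * |deriv Z q| * |hq| * G) := by
          rw [abs_mul (4 * q), abs_of_nonneg (by positivity : 0 ≤ 4 * q)]
          refine add_le_add (le_of_eq ?_) ?_
          · rw [abs_mul, abs_mul, abs_of_nonneg (by positivity : 0 ≤ 2 * n), abs_of_pos hG0]
          · refine mul_le_mul_of_nonneg_left ((abs_add_le _ _).trans (le_of_eq ?_)) (by positivity)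
            rw [abs_mul, abs_mul, abs_mul, abs_mul, abs_of_pos hG0]
            norm_num
        _ ≤ 2 * n * KZ * G + 4 * τ * (KZ * G + 2 * KZ * (2 * M / s) * G) := by gcongr
        _ = KZ * (2 * n + 4 * τ) * G + KZ * (16 * τ * M) * (G * (1 / s)) := by ring
        _ ≤ KZ * (2 * n + 4 * τ) * (G * (1 + 1 / s))
            + KZ * (16 * τ * M) * (G * (1 + 1 / s)) := by
          have h3 : 0 ≤ 1 / s := by positivity
          have h4 : G ≤ G * (1 + 1 / s) := le_mul_of_one_le_right hG0.le (by linarith)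
          have h5 : G * (1 / s) ≤ G * (1 + 1 / s) := by gcongr; linarith
          gcongr
        _ = _ := by ring
    have hGs : G * (1 + 1 / s) ≤ E * K₀ := by
      have h1 := hK₀' s hs
      have h2 : Real.exp (-(n / 2) * Real.log s - b₀ * q / (8 * s))
          ≤ Real.exp (-(n / 2) * Real.log s - d * τ / 32 / s) := by
        have h3 : d * τ / 4 ≤ b₀ * q := by
          have := mul_le_mul hb hq4 (by positivity) (by linarith)
          linarith
        have h4 : d * τ / 32 / s = d * τ / 4 / (8 * s) := by field_simp; norm_num
        rw [h4]
        gcongr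
      calc G * (1 + 1 / s) ≤ E * Real.exp (-(n / 2) * Real.log s - d * τ / 32 / s) * (1 + 1 / s) := by
            gcongr
            exact hGup.trans (by gcongr)
        _ = E * (Real.exp (-(n / 2) * Real.log s - d * τ / 32 / s) * (1 + 1 / s)) := by ring
        _ ≤ _ := by gcongr
    have hTle : (1 - χ s) * θ s ≤ 1 := mul_le_one₀ (by linarith) hθ0 hθ1
    have hT0' : 0 ≤ (1 - χ s) * θ s := mul_nonneg (by linarith) hθ0
    have hXC : |2 * n * deriv Z q * G + 4 * q * (deriv (deriv Z) q * G + 2 * deriv Z q * hq * G)|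
        ≤ C₁ := hX.trans (by rw [hC₁]; gcongr)
    calc _ ≤ (1 - χ s) * θ s * C₁ :=
          mul_le_mul_of_nonneg_left ((le_abs_self _).trans hXC) hT0'
      _ ≤ 1 * C₁ := by gcongr
      _ = C₁ := one_mul _
  -- the outer time cut-off
  have t3 : -(b * ((1 - χ s) * deriv θ s) * Z q * G) ≤ C₂ := by
    rcases lt_or_ge s (τ / 2) with hs2 | hs2
    · rw [hθ.deriv_eq_zero (.inl hs2)]
      simpa using hC₂0
    have h1 := (abs_le.1 (hKθ s).1).1
    have h2 : G ≤ E * Real.exp (-(n / 2) * Real.log (τ / 2)) := by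
      refine hGup.trans ?_
      have h3 : Real.log (τ / 2) ≤ Real.log s := Real.log_le_log (by positivity) hs2
      have h4 : 0 ≤ b₀ * q / (8 * s) :=
        div_nonneg (mul_nonneg (by linarith) hq0) (by positivity)
      have h5 := mul_le_mul_of_nonneg_left h3 (by positivity : 0 ≤ n / 2)
      gcongr
      linarith
    have h3 : 0 ≤ 1 - χ s := by linarith
    have h0 : 0 ≤ b := by linarith
    calc _ = b * ((1 - χ s) * -deriv θ s) * Z q * G := by ring
      _ ≤ M * (1 * Kθ) * 1 * (E * Real.exp (-(n / 2) * Real.log (τ / 2))) := by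
        have h5 := hθ.deriv_nonpos s
        have : 0 ≤ -deriv θ s := by linarith
        have : 0 ≤ M := by linarith
        gcongr <;> linarith
      _ = C₂ := by rw [hC₂]; ring
  -- the inner time cut-off
  have t4 : d / 4 * Real.exp (-(n / 2) * Real.log (2 * ε) - M / 4)
      * (-deriv χ s * (closedBall yp √ε).indicator (fun _ => 1) p.2)
      ≤ b * (-deriv χ s * θ s) * Z q * G := by
    have h1 : 0 ≤ -deriv χ s := by linarith [hχ.deriv_nonpos s]
    have h0 : 0 ≤ b := by linarith
    by_cases hsε : s < ε ∨ 2 * ε < s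
    · rw [hχ.deriv_eq_zero hsε]; simp
    push Not at hsε
    by_cases hqε : p.2 ∈ closedBall yp √ε
    · have hqε' : q ≤ ε := by
        rw [mem_closedBall, dist_eq_norm] at hqε
        have : q ≤ √ε ^ 2 := by rw [hqdef]; gcongr
        rwa [Real.sq_sqrt hε.le] at this
      rw [indicator_of_mem hqε, hθ.eq_one s (by linarith), hZ.eq_one q (by linarith)]
      have h2 : Real.exp (-(n / 2) * Real.log (2 * ε) - M / 4) ≤ G := by
        refine le_trans ?_ hGlow
        have h3 : Real.log s ≤ Real.log (2 * ε) := Real.log_le_log hs hsε.2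
        have h4 : b₀ * q / (4 * s) ≤ M / 4 := by
          rw [div_le_div_iff₀ (by positivity) (by norm_num)]
          have : b₀ * q ≤ M * s := by
            refine mul_le_mul hb₀M (by linarith) hq0 (by linarith)
          linarith
        have h5 := mul_le_mul_of_nonneg_left h3 (by positivity : 0 ≤ n / 2)
        refine Real.exp_le_exp.2 ?_
        linarith
      calc _ = d / 4 * -deriv χ s * Real.exp (-(n / 2) * Real.log (2 * ε) - M / 4) := by ring
        _ ≤ b * -deriv χ s * G := by gcongr
        _ = _ := by ring
    · rw [indicator_of_notMem hqε]
      simp only [mul_zero]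
      positivity
  linarith

lemma window_subset_cylD {N : ℕ} {ς x₀ τ : ℝ} {y₀ : Euc N} (hς : ς = 1 ∨ ς = -1)
    (hx₀ : x₀ ∈ Icc (0 : ℝ) 1) (hy₀ : y₀ ∈ ball 0 1) (hτ1 : τ ≤ 1) :
    window ς x₀ y₀ τ ⊆ cylD N := by
  rintro p ⟨⟨h1, h2⟩, h3⟩
  refine ⟨?_, ?_⟩
  · obtain ⟨h4, h5⟩ := hx₀
    rcases hς with rfl | rfl <;> constructor <;> linarith
  · have h4 : ‖p.2 - y₀‖ ≤ 1 := by
      refine abs_le_of_sq_le_sq' ?_ zero_le_one |>.2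
      linarith
    rw [mem_ball_zero_iff] at hy₀ ⊢
    calc ‖p.2‖ = ‖p.2 - y₀ + y₀‖ := by simp
      _ ≤ ‖p.2 - y₀‖ + ‖y₀‖ := norm_add_le _ _
      _ < 3 := by linarith

lemma Icc_prod_closedBall_subset_cylD {N : ℕ} {x₁ t r : ℝ} {y₁ : Euc N}
    (hx₁ : x₁ ∈ Icc (-1 : ℝ) 2) (hy₁ : y₁ ∈ ball 0 2) (ht : t ≤ 3) (hr : r ≤ 1) :
    Icc (x₁ - t) (x₁ + t) ×ˢ closedBall y₁ r ⊆ cylD N := by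
  rintro p ⟨⟨h1, h2⟩, h3⟩
  obtain ⟨h4, h5⟩ := hx₁
  refine ⟨by constructor <;> linarith, ?_⟩
  rw [mem_closedBall, dist_eq_norm] at h3
  rw [mem_ball_zero_iff] at hy₁ ⊢
  calc ‖p.2‖ = ‖p.2 - y₁ + y₁‖ := by simp
    _ ≤ ‖p.2 - y₁‖ + ‖y₁‖ := norm_add_le _ _
    _ < 3 := by linarith

lemma setIntegral_mul_indicator_const {N : ℕ} {u : ℝ × Euc N → ℝ} {W : Set (ℝ × Euc N)} (C : ℝ)
    (hW : MeasurableSet W) (hWs : W ⊆ cylD N) :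
    ∫ p in cylD N, u p * W.indicator (fun _ => C) p = C * ∫ p in W, u p := by
  have : ∀ p, u p * W.indicator (fun _ => C) p = W.indicator (fun p => C * u p) p := by
    intro p
    by_cases hp : p ∈ W
    · simp [hp, mul_comm]
    · simp [hp]
  simp_rw [this]
  rw [setIntegral_indicator hW, inter_eq_self_of_subset_right hWs, integral_const_mul]

lemma exp_log_mul_volume_closedBall {N : ℕ} (yp : Euc N) {ε a : ℝ} (hε : 0 < ε) :
    Real.exp (-(((N - 1 : ℕ) : ℝ) / 2) * Real.log (2 * ε) - a) * volume.real (closedBall yp √ε)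
      = Real.exp (-(((N - 1 : ℕ) : ℝ) / 2) * Real.log 2 - a) * volume.real (ball (0 : Euc N) 1) := by
  have h1 : volume.real (closedBall yp √ε) = √ε ^ (N - 1) * volume.real (ball (0 : Euc N) 1) := by
    rw [Measure.real, Measure.addHaar_closedBall _ _ (Real.sqrt_nonneg _), ENNReal.toReal_mul,
      ENNReal.toReal_ofReal (by positivity), finrank_euclideanSpace_fin, Measure.real]
  have h2 : √ε ^ (N - 1) = Real.exp (((N - 1 : ℕ) : ℝ) / 2 * Real.log ε) := by
    rw [← Real.exp_log (Real.sqrt_pos.2 hε), ← Real.exp_nat_mul, Real.log_sqrt hε.le]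
    congr 1
    ring
  rw [h1, h2, ← mul_assoc, ← Real.exp_add, Real.log_mul (by norm_num) hε.ne']
  congr 2
  ring

lemma Scale.exists_upper_const {N : ℕ} {d M lam ρ τ : ℝ} (hS : Scale N d M lam ρ)
    (hτ : 0 < τ) (hτ1 : τ ≤ 1) (hτρ : τ + lam * τ ≤ ρ ^ 2) :
    ∃ C, 0 ≤ C ∧ ∀ {β : Euc N → ℝ} {γ u : ℝ × Euc N → ℝ}, CoeffBound β M → NonnegSolution β γ u →
      ∀ {ς : ℝ}, (ς = 1 ∨ ς = -1) → ∀ {x₀ : ℝ} {y₀ : Euc N}, x₀ ∈ Icc (0 : ℝ) 1 →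
      y₀ ∈ ball 0 1 → d ≤ ς * β y₀ → u (x₀, y₀) ≤ C * ∫ p in window ς x₀ y₀ τ, u p := by
  obtain ⟨θ, hθ⟩ := exists_isCutoff (by linarith : τ / 2 < τ)
  obtain ⟨Z, hZ⟩ := exists_isCutoff (by linarith : τ / 4 < τ)
  obtain ⟨C₁, hC₁, H⟩ := hS.exists_adj_upper_bound hτ hτ1 hτρ hθ hZ
  set n : ℝ := ((N - 1 : ℕ) : ℝ) with hn
  have hd := hS.d_pos
  have hlam := hS.four_le
  set c₀ := d / 4 * (Real.exp (-(n / 2) * Real.log 2 - M / 4) * volume.real (ball (0 : Euc N) 1))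
    with hc₀
  have hv : 0 < volume.real (ball (0 : Euc N) 1) :=
    ENNReal.toReal_pos (measure_ball_pos _ _ one_pos).ne' measure_ball_lt_top.ne
  have hc₀' : 0 < c₀ := by positivity
  refine ⟨C₁ / c₀, by positivity, ?_⟩
  intro β γ u hβ hu ς hς x₀ y₀ hx₀ hy₀ hb
  have hW := window_subset_cylD hς hx₀ hy₀ hτ1
  have hp₀ : (x₀, y₀) ∈ cylD N := by
    refine hW ⟨?_, ?_⟩ <;> simp [hτ.le]
  rw [div_mul_eq_mul_div, le_div_iff₀ hc₀', mul_comm]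
  suffices h : ∀ η > 0, c₀ * (u (x₀, y₀) - η) ≤ C₁ * ∫ p in window ς x₀ y₀ τ, u p by
    refine le_of_forall_pos_le_add fun η hη => ?_
    have := h (η / c₀) (by positivity)
    rw [mul_sub, mul_div_cancel₀ _ hc₀'.ne'] at this
    linarith
  intro η hη
  obtain ⟨δ, hδ, hδu⟩ := Metric.continuousAt_iff.1
    (hu.cont.continuousAt ((isOpen_cylD N).mem_nhds hp₀)) η hη
  obtain ⟨ε, hε, hετ, hε1, hε2⟩ : ∃ ε > 0, ε ≤ τ / 8 ∧ 2 * ε < δ ∧ √ε < δ := by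
    refine ⟨min (τ / 8) (min (δ / 4) (δ ^ 2 / 4)), by positivity, min_le_left _ _, ?_, ?_⟩
    · have : min (τ / 8) (min (δ / 4) (δ ^ 2 / 4)) ≤ δ / 4 :=
        (min_le_right _ _).trans (min_le_left _ _)
      linarith
    · have : min (τ / 8) (min (δ / 4) (δ ^ 2 / 4)) ≤ δ ^ 2 / 4 :=
        (min_le_right _ _).trans (min_le_right _ _)
      rw [Real.sqrt_lt' hδ]
      have : 0 < δ ^ 2 := by positivity
      linarith
  obtain ⟨χ, hχ⟩ := exists_isCutoff (by linarith : ε < 2 * ε)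
  have hT : ContDiff ℝ (⊤ : ℕ∞) fun s => (1 - χ s) * θ s :=
    (contDiff_const.sub hχ.contDiff).mul hθ.contDiff
  have hT0 : ∀ s ≤ ε, (1 - χ s) * θ s = 0 := fun s hs => by rw [hχ.eq_one s hs]; ring
  have hsupp : tsupport (kerTest ς x₀ y₀ (ς * β y₀) lam (-1 * M) (fun s => (1 - χ s) * θ s) Z id)
      ⊆ Icc (x₀ - τ) (x₀ + τ) ×ˢ closedBall y₀ √τ := by
    refine tsupport_kerTest_subset hς (Real.sqrt_pos.2 hτ) (fun s hs => hT0 s (by linarith))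
      (fun s hs => by rw [hθ.eq_zero s hs, mul_zero]) fun q hq => hZ.eq_zero q ?_
    rwa [Real.sq_sqrt hτ.le] at hq
  have hbox : Icc (x₀ - τ) (x₀ + τ) ×ˢ closedBall y₀ √τ ⊆ cylD N :=
    Icc_prod_closedBall_subset_cylD ⟨by linarith [hx₀.1], by linarith [hx₀.2]⟩
      (ball_subset_ball (by norm_num) hy₀) (by linarith) (Real.sqrt_le_one.2 hτ1)
  set κ := d / 4 * Real.exp (-(n / 2) * Real.log (2 * ε) - M / 4) with hκ
  have hκ0 : 0 ≤ κ := by positivity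
  set D : ℝ × Euc N → ℝ := fun p => κ * (-deriv χ (ς * (p.1 - x₀))
    * (closedBall y₀ √ε).indicator (fun _ => 1) p.2) with hD
  have hDint : Integrable D := by
    refine Integrable.const_mul ?_ _
    exact (hχ.integrable_neg_deriv_comp hς x₀).mul_prod
      ((integrable_indicator_iff isClosed_closedBall.measurableSet).2
        (integrableOn_const measure_closedBall_lt_top.ne))
  have hDval : ∫ p, D p = c₀ := by
    rw [hD, integral_const_mul, Measure.volume_eq_prod,
      integral_prod_mul (fun x => -deriv χ (ς * (x - x₀)))
        ((closedBall y₀ √ε).indicator fun _ => (1 : ℝ)), hχ.integral_neg_deriv_comp hς,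
      integral_indicator_const _ isClosed_closedBall.measurableSet, one_mul, smul_eq_mul, mul_one,
      hκ, hc₀, mul_assoc, exp_log_mul_volume_closedBall y₀ hε]
  have hD0 : ∀ p, 0 ≤ D p := fun p => mul_nonneg hκ0 (mul_nonneg
    (neg_nonneg.2 (hχ.deriv_nonpos _)) (indicator_nonneg (fun _ _ => zero_le_one) _))
  have hDs : ∀ p, D p ≠ 0 → dist p (x₀, y₀) < δ ∧ p ∈ cylD N := by
    intro p hp
    have h1 := left_ne_zero_of_mul (right_ne_zero_of_mul hp)
    have h2 : p.2 ∈ closedBall y₀ √ε := by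
      by_contra hc
      exact right_ne_zero_of_mul (right_ne_zero_of_mul hp) (indicator_of_notMem hc _)
    have h3 : ¬ (ς * (p.1 - x₀) < ε ∨ 2 * ε < ς * (p.1 - x₀)) := fun hc => h1 (by
      rw [hχ.deriv_eq_zero hc, neg_zero])
    push Not at h3
    have h4 : |p.1 - x₀| ≤ 2 * ε := by
      rcases hς with rfl | rfl <;> rw [abs_le] <;> constructor <;> linarith
    refine ⟨?_, hbox ⟨?_, closedBall_subset_closedBall (Real.sqrt_le_sqrt (by linarith)) h2⟩⟩
    · rw [Prod.dist_eq, max_lt_iff, Real.dist_eq]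
      exact ⟨by linarith, (mem_closedBall.1 h2).trans_lt hε2⟩
    · rw [abs_le] at h4
      constructor <;> linarith
  obtain ⟨K, hK0, hK⟩ := hχ.exists_bound
  have hDu : IntegrableOn (fun p => u p * D p) (cylD N) := by
    refine hu.integrableOn_mul (C := κ * (K * 1)) hDint.aestronglyMeasurable.restrict
      (.of_forall fun p => ?_)
    rw [hD]
    simp only [abs_mul, abs_neg, abs_of_nonneg hκ0]
    refine mul_le_mul_of_nonneg_left (mul_le_mul (hK _).1 ?_ (abs_nonneg _) hK0) hκ0
    rw [abs_of_nonneg (indicator_nonneg (fun _ _ => zero_le_one) _)]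
    exact indicator_le_self' (fun _ _ => zero_le_one) _
  have key := hu.integral_le_of_adj_le hβ (σ := 1) (.inl rfl)
    (contDiff_kerTest (by linarith) hT hZ.contDiff contDiff_id hε hT0)
    (HasCompactSupport.of_support_subset_isCompact (isCompact_Icc.prod (isCompact_closedBall _ _))
      ((subset_tsupport _).trans hsupp)) (hsupp.trans hbox)
    (A := (window ς x₀ y₀ τ).indicator fun _ => C₁) (D := D) ?_ ?_ ?_ ?_
  · rw [setIntegral_mul_indicator_const C₁ (measurableSet_window _ _ _ _) hW] at key
    refine le_trans ?_ key
    rw [← hDval, ← setIntegral_eq_integral_of_forall_compl_eq_zero (s := cylD N)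
      fun p hp => by_contra fun h => hp (hDs p h).2, ← integral_mul_const]
    refine setIntegral_mono_on (hDint.integrableOn.mul_const _) hDu
      (isOpen_cylD N).measurableSet fun p _ => ?_
    rw [mul_comm]
    by_cases hp : D p = 0
    · simp [hp]
    · refine mul_le_mul_of_nonneg_right ?_ (hD0 p)
      have := (abs_lt.1 (hδu (hDs p hp).1)).1
      linarith
  · intro p
    refine mul_nonneg (mul_nonneg (mul_nonneg ?_ (hθ.nonneg _)) (hZ.nonneg _)) (Real.exp_pos _).le
    linarith [hχ.le_one (ς * (p.1 - x₀))]
  · refine hu.integrableOn_mul (C := C₁) ?_ (.of_forall fun p => ?_)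
    · exact (measurable_const.indicator (measurableSet_window _ _ _ _)).aestronglyMeasurable
    · rw [abs_of_nonneg (indicator_nonneg (fun _ _ => hC₁) _)]
      exact indicator_le_self' (fun _ _ => hC₁) _
  · exact hDu
  · intro p hp
    rw [one_mul]
    exact H hβ hς hy₀ hb hε hετ hχ p hp

/-- Smooth convex truncations vanishing on `(-∞, κ]` with slope `1` on `[κ + 1, ∞)`. -/
structure IsTruncation (κ : ℝ) (f : ℝ → ℝ) : Prop where
  contDiff : ContDiff ℝ (⊤ : ℕ∞) f
  eq_zero : ∀ t ≤ κ, f t = 0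
  deriv_eq_zero : ∀ t ≤ κ, deriv f t = 0
  deriv_eq_one : ∀ t, κ + 1 ≤ t → deriv f t = 1
  deriv_nonneg : ∀ t, 0 ≤ deriv f t
  deriv_deriv_nonneg : ∀ t, 0 ≤ deriv (deriv f) t
  nonneg : ∀ t, 0 ≤ f t
  le_self : ∀ t, 0 ≤ t → f t ≤ t
  le_deriv_mul : ∀ t, 0 ≤ t → f t ≤ deriv f t * t

lemma exists_isTruncation {κ : ℝ} (hκ : 0 ≤ κ) : ∃ f, IsTruncation κ f := by
  set h : ℝ → ℝ := fun t => Real.smoothTransition (t - κ) with hh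
  have hhc : ContDiff ℝ (⊤ : ℕ∞) h :=
    Real.smoothTransition.contDiff.comp (contDiff_id.sub contDiff_const)
  have hmono : Monotone h := fun a b hab => Real.smoothTransition.monotone (by gcongr)
  have hd : ∀ t, HasDerivAt (fun t => ∫ x in κ..t, h x) (h t) t := fun t =>
    intervalIntegral.integral_hasDerivAt_right (hhc.continuous.intervalIntegrable _ _)
      hhc.continuous.stronglyMeasurable.stronglyMeasurableAtFilter hhc.continuous.continuousAt
  have hderiv : deriv (fun t => ∫ x in κ..t, h x) = h := funext fun t => (hd t).deriv
  have h0 : ∀ t ≤ κ, h t = 0 := fun t ht =>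
    Real.smoothTransition.zero_of_nonpos (by linarith)
  have hle : ∀ t, h t ≤ 1 := fun t => Real.smoothTransition.le_one _
  have hnn : ∀ t, 0 ≤ h t := fun t => Real.smoothTransition.nonneg _
  have hz : ∀ t ≤ κ, ∫ x in κ..t, h x = 0 := by
    intro t ht
    rw [intervalIntegral.integral_congr (g := fun _ => 0)]
    · simp
    · intro x hx
      rw [uIcc_of_ge ht] at hx
      exact h0 x hx.2
  have hb : ∀ t, κ ≤ t → ∫ x in κ..t, h x ≤ h t * (t - κ) := by
    intro t ht
    calc ∫ x in κ..t, h x ≤ ∫ _ in κ..t, h t :=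
          intervalIntegral.integral_mono_on ht (hhc.continuous.intervalIntegrable _ _) (by simp)
            fun x hx => hmono hx.2
      _ = _ := by simp [mul_comm]
  refine ⟨fun t => ∫ x in κ..t, h x, ?_, hz, ?_, ?_, ?_, ?_, ?_, ?_, ?_⟩
  · rw [contDiff_infty_iff_deriv, hderiv]
    exact ⟨fun t => (hd t).differentiableAt, hhc⟩
  · rw [hderiv]; exact h0
  · rw [hderiv]
    exact fun t ht => Real.smoothTransition.one_of_one_le (by linarith)
  · rw [hderiv]; exact hnn
  · rw [hderiv]; exact fun t => hmono.deriv_nonneg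
  · intro t
    rcases le_total t κ with ht | ht
    · exact (hz t ht).ge
    · exact intervalIntegral.integral_nonneg ht fun x _ => hnn x
  · intro t ht0
    rcases le_total t κ with ht | ht
    · exact (hz t ht).trans_le ht0
    · refine (hb t ht).trans ?_
      have := mul_le_mul_of_nonneg_right (hle t) (sub_nonneg.2 ht)
      linarith
  · intro t ht0
    rw [hderiv]
    rcases le_total t κ with ht | ht
    · exact (hz t ht).trans_le (mul_nonneg (hnn t) ht0)
    · exact (hb t ht).trans (mul_le_mul_of_nonneg_left (by linarith) (hnn t))

set_option maxHeartbeats 1000000 in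
/-- The test function behind the local lower bound. -/
lemma Scale.adj_lower_bound {N : ℕ} {d M lam ρ τ r κ : ℝ} (hS : Scale N d M lam ρ)
    (hτ1 : 3 * τ ≤ 1) (hτr : 16 * τ ≤ r ^ 2)
    (hτρ : r ^ 2 + lam * (3 * τ) ≤ ρ ^ 2)
    (hκ2 : 2 ≤ κ) (hκK : ∀ s, 0 < s →
      Real.exp (-(((N - 1 : ℕ) : ℝ) / 2) * Real.log s - d * r ^ 2 / 32 / s) ≤ κ)
    (hκτ : 2 * κ ≤ Real.exp (-(((N - 1 : ℕ) : ℝ) / 2) * Real.log (2 * τ)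
      - (M + M * (4 + lam) / 18)))
    {θ Z f : ℝ → ℝ} (hθ : IsCutoff (2 * τ) (3 * τ) θ) (hZ : IsCutoff (r ^ 2 / 4) (r ^ 2) Z)
    (hf : IsTruncation κ f) {β : Euc N → ℝ} (hβ : CoeffBound β M) {ς : ℝ} (hς : ς = 1 ∨ ς = -1)
    {xp : ℝ} {yp : Euc N} (hyp : yp ∈ ball 0 2) (hb : d / 2 ≤ ς * β yp) {ε : ℝ} (hε : 0 < ε)
    (hετ : 2 * ε ≤ τ) {χ : ℝ → ℝ} (hχ : IsCutoff ε (2 * ε) χ) {W : Set (ℝ × Euc N)}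
    (hW : ∀ p ∈ W, ς * (p.1 - xp) ∈ Icc τ (2 * τ) ∧ ‖p.2 - yp‖ ^ 2 ≤ 4 * τ)
    {p : ℝ × Euc N} (hp : p ∈ cylD N) :
    -1 * (lapY (kerTest ς xp yp (ς * β yp) lam (1 * M) (fun s => (1 - χ s) * θ s) Z f) p
        - β p.2 * dX (kerTest ς xp yp (ς * β yp) lam (1 * M) (fun s => (1 - χ s) * θ s) Z f) p)
        + kerTest ς xp yp (ς * β yp) lam (1 * M) (fun s => (1 - χ s) * θ s) Z f p
      ≤ M * (-deriv χ (ς * (p.1 - xp)) * Real.exp (-(((N - 1 : ℕ) : ℝ) / 2) * Real.log ε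
          - d / (16 * ε) * ‖p.2 - yp‖ ^ 2)) - W.indicator (fun _ => 1) p := by
  set n : ℝ := ((N - 1 : ℕ) : ℝ) with hn
  have hn0 : 0 ≤ n := Nat.cast_nonneg _
  have hd := hS.d_pos
  have hM := hS.one_le
  have hlam := hS.four_le
  have hT : ContDiff ℝ (⊤ : ℕ∞) fun s => (1 - χ s) * θ s :=
    (contDiff_const.sub hχ.contDiff).mul hθ.contDiff
  have hT0 : ∀ s ≤ ε, (1 - χ s) * θ s = 0 := fun s hs => by rw [hχ.eq_one s hs]; ring
  have hyp3 : yp ∈ ball (0 : Euc N) 3 := ball_subset_ball (by norm_num) hyp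
  set s := ς * (p.1 - xp) with hsdef
  set q := ‖p.2 - yp‖ ^ 2 with hqdef
  set Γ := Real.exp (-(n / 2) * Real.log ε - d / (16 * ε) * q) with hΓ
  have hχ' : 0 ≤ -deriv χ s := neg_nonneg.2 (hχ.deriv_nonpos s)
  have hD0 : 0 ≤ M * (-deriv χ s * Γ) := by positivity
  have hnot : (s ≤ 0 ∨ 3 * τ < s ∨ r ^ 2 < q) → W.indicator (fun _ => (1 : ℝ)) p = 0 := by
    intro h
    refine indicator_of_notMem (fun hc => ?_) _
    obtain ⟨⟨h1, h2⟩, h3⟩ := hW p hc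
    rcases h with h | h | h <;> linarith
  rcases le_or_gt s 0 with hs | hs
  · rw [adj_kerTest_of_nonpos hε hT0 hs, (kerTest_eventuallyEq_zero hε hT0 hs).eq_of_nhds,
      hnot (.inl hs)]
    simpa using hD0
  set b₀ := ς * β yp with hb₀
  set G := Real.exp (logKer n b₀ lam (1 * M) s q) with hGdef
  set hq := -b₀ / (4 * s) - 3 / 2 * (1 * M) * √(q + lam * s) / s with hhq
  have hG0 : 0 < G := Real.exp_pos _
  have hq0 : 0 ≤ q := by positivity
  have hdT : deriv (fun s => (1 - χ s) * θ s) s = -deriv χ s * θ s + (1 - χ s) * deriv θ s :=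
    (((hχ.hasDerivAt s).const_sub 1).mul (hθ.hasDerivAt s)).deriv
  rw [adj_kerTest (by linarith) hT hZ.contDiff hf.contDiff hs hsdef hqdef hGdef hhq, hdT]
  have hval : kerTest ς xp yp b₀ lam (1 * M) (fun s => (1 - χ s) * θ s) Z f p
      = (1 - χ s) * θ s * Z q * f G := rfl
  rw [hval]
  have hχ0 := hχ.nonneg s
  have hχ1 := hχ.le_one s
  have hθ0 := hθ.nonneg s
  have hθ1 := hθ.le_one s
  have hZ0 := hZ.nonneg q
  have hZ1 := hZ.le_one q
  by_cases hout : 3 * τ < s ∨ r ^ 2 < q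
  · rw [hnot (.inr hout), sub_zero]
    refine le_trans (le_of_eq ?_) hD0
    rcases hout with h | h
    · rw [hθ.deriv_eq_zero (.inr h), hθ.eq_zero s h.le]; ring
    · rw [hZ.deriv_eq_zero (.inr h), hZ.deriv_deriv_eq_zero (.inr h), hZ.eq_zero q h.le]; ring
  push Not at hout
  obtain ⟨hsτ, hqτ⟩ := hout
  have hRρ : q + lam * s ≤ ρ ^ 2 := by
    have : lam * s ≤ lam * (3 * τ) := by gcongr
    linarith
  obtain ⟨hR, hb₀M, hbd, hbM, hP⟩ := hS.adjKer_bound hβ hς hyp3 hp.2 hb hs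
    (by linarith) hRρ (σ := 1) (.inl rfl)
  rw [← hqdef, ← hn, ← hb₀, one_mul] at hP
  rw [← hb₀] at hR hb₀M
  set P := adjKer n b₀ lam (1 * M) (ς * β p.2) s q with hPdef
  set b := ς * β p.2 with hbdef
  have hGup : G ≤ Real.exp (-(n / 2) * Real.log s - b₀ * q / (4 * s)) :=
    Real.exp_le_exp.2 (logKer_le_of_nonneg hs (by linarith))
  have hTn : 0 ≤ (1 - χ s) * θ s := mul_nonneg (by linarith) hθ0
  have hf0 := hf.nonneg G
  have hf1 := hf.le_deriv_mul G hG0.le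
  have hf2 := hf.le_self G hG0.le
  -- the spatial cut-off
  have t2 : 2 * n * deriv Z q * f G
      + 4 * q * (deriv (deriv Z) q * f G + 2 * deriv Z q * deriv f G * hq * G) = 0 := by
    rcases lt_or_ge q (r ^ 2 / 4) with hq4 | hq4
    · rw [hZ.deriv_eq_zero (.inl hq4), hZ.deriv_deriv_eq_zero (.inl hq4)]
      ring
    have hGκ : G ≤ κ := by
      refine hGup.trans (le_trans ?_ (hκK s hs))
      refine Real.exp_le_exp.2 ?_
      have h3 : d * r ^ 2 / 8 ≤ b₀ * q := by
        have := mul_le_mul hb hq4 (by positivity) (by linarith)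
        linarith
      have h4 : d * r ^ 2 / 32 / s = d * r ^ 2 / 8 / (4 * s) := by field_simp; ring
      have : d * r ^ 2 / 8 / (4 * s) ≤ b₀ * q / (4 * s) := by gcongr
      linarith
    rw [hf.eq_zero G hGκ, hf.deriv_eq_zero G hGκ]
    ring
  -- the outer time cut-off
  have t3 : 0 ≤ -(b * ((1 - χ s) * deriv θ s) * Z q * f G) := by
    have h1 : 0 ≤ -deriv θ s := neg_nonneg.2 (hθ.deriv_nonpos s)
    have h2 : 0 ≤ 1 - χ s := by linarith
    have h3 : 0 ≤ b := by linarith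
    have : 0 ≤ b * ((1 - χ s) * -deriv θ s) * Z q * f G := by positivity
    linarith
  -- the inner time cut-off
  have t4 : b * (-deriv χ s * θ s) * Z q * f G ≤ M * (-deriv χ s * Γ) := by
    by_cases hsε : s < ε ∨ 2 * ε < s
    · rw [hχ.deriv_eq_zero hsε]; simp
    push Not at hsε
    have hGΓ : G ≤ Γ := by
      refine hGup.trans (Real.exp_le_exp.2 ?_)
      have h3 : Real.log ε ≤ Real.log s := Real.log_le_log hε hsε.1
      have h5 := mul_le_mul_of_nonneg_left h3 (by positivity : 0 ≤ n / 2)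
      have h4 : d / (16 * ε) * q ≤ b₀ * q / (4 * s) := by
        rw [div_mul_eq_mul_div, div_le_div_iff₀ (by positivity) (by positivity)]
        have h6 : d / 2 * q * (4 * s) ≤ b₀ * q * (4 * (2 * ε)) := by
          refine mul_le_mul (mul_le_mul_of_nonneg_right hb hq0) (by linarith) (by positivity)
            (mul_nonneg (by linarith) hq0)
        linarith
      linarith
    have h3 : 0 ≤ b := by linarith
    calc b * (-deriv χ s * θ s) * Z q * f G ≤ M * (-deriv χ s * 1) * 1 * Γ := by
          have : f G ≤ Γ := hf2.trans hGΓ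
          have : 0 ≤ M := by linarith
          gcongr
      _ = _ := by ring
  -- the bulk term
  have t1 : W.indicator (fun _ => (1 : ℝ)) p ≤ (1 - χ s) * θ s * Z q * (deriv f G * G * P
      + 4 * q * deriv (deriv f) G * hq ^ 2 * G ^ 2) - (1 - χ s) * θ s * Z q * f G := by
    have hTZ : 0 ≤ (1 - χ s) * θ s * Z q := mul_nonneg hTn hZ0
    have hfd : 0 ≤ deriv f G * G := mul_nonneg (hf.deriv_nonneg G) hG0.le
    have h1 : 0 ≤ 4 * q * deriv (deriv f) G * hq ^ 2 * G ^ 2 := by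
      have := hf.deriv_deriv_nonneg G
      positivity
    have h2 : deriv f G * G * 2 ≤ deriv f G * G * P := mul_le_mul_of_nonneg_left hP hfd
    have h3 : (1 - χ s) * θ s * Z q * (deriv f G * G)
        ≤ (1 - χ s) * θ s * Z q * (deriv f G * G * P
      + 4 * q * deriv (deriv f) G * hq ^ 2 * G ^ 2 - f G) :=
      mul_le_mul_of_nonneg_left (by linarith) hTZ
    rw [mul_sub] at h3
    refine le_trans ?_ h3
    by_cases hpW : p ∈ W
    · obtain ⟨⟨h4, h5⟩, h6⟩ := hW p hpW
      rw [indicator_of_mem hpW, hχ.eq_zero s (by linarith), hθ.eq_one s h5,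
        hZ.eq_one q (by linarith)]
      have hGlow : 2 * κ ≤ G := by
        refine hκτ.trans (Real.exp_le_exp.2 ?_)
        have h7 := (abs_le.1 (abs_logKer_add_le (n := n) (b₀ := b₀) (kap := 1 * M) hs hq0
          (by linarith : 0 < lam) (by rw [one_mul, abs_of_pos (by linarith)]; exact hR))).1
        have h8 : Real.log s ≤ Real.log (2 * τ) := Real.log_le_log hs h5
        have h9 := mul_le_mul_of_nonneg_left h8 (by positivity : 0 ≤ n / 2)
        have h10 : q / s ≤ 4 := by rw [div_le_iff₀ hs]; linarith
        have h11 : b₀ * q / (4 * s) ≤ M := by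
          have : b₀ * q / (4 * s) = b₀ * (q / s) / 4 := by field_simp
          rw [this]
          have : b₀ * (q / s) ≤ M * 4 := mul_le_mul hb₀M h10 (by positivity) (by linarith)
          linarith
        have h12 : b₀ / 18 * (q / s + lam) ≤ M / 18 * (4 + lam) :=
          mul_le_mul (by linarith) (by linarith) (by positivity) (by linarith)
        linarith
      rw [hf.deriv_eq_one G (by linarith)]
      linarith
    · rw [indicator_of_notMem hpW]
      positivity
  linear_combination t1 + t4 + t3 - (1 - χ s) * θ s * t2

/-- The Gaussians of width `√ε` have an integral which does not depend on `ε`. -/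
lemma integral_gaussian_eq {N : ℕ} (yp : Euc N) {ε a : ℝ} (hε : 0 < ε) (ha : 0 < a) :
    ∫ y, Real.exp (-(((N - 1 : ℕ) : ℝ) / 2) * Real.log ε - a / ε * ‖y - yp‖ ^ 2)
      = (Real.pi / a) ^ (((N - 1 : ℕ) : ℝ) / 2) := by
  have hrw : ∀ y : Euc N, Real.exp (-(((N - 1 : ℕ) : ℝ) / 2) * Real.log ε - a / ε * ‖y - yp‖ ^ 2)
      = Real.exp (-(((N - 1 : ℕ) : ℝ) / 2) * Real.log ε)
        * Real.exp (-(a / ε) * ‖y - yp‖ ^ 2) := fun y => by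
    rw [← Real.exp_add]; congr 1; ring
  simp_rw [hrw]
  rw [integral_const_mul, integral_sub_right_eq_self (fun y => Real.exp (-(a / ε) * ‖y‖ ^ 2)) yp,
    GaussianFourier.integral_rexp_neg_mul_sq_norm (by positivity), finrank_euclideanSpace_fin,
    show Real.pi / (a / ε) = Real.pi / a * ε by field_simp,
    Real.mul_rpow (by positivity) hε.le, Real.rpow_def_of_pos hε, mul_comm, mul_assoc,
    ← Real.exp_add]
  rw [show Real.log ε * (((N - 1 : ℕ) : ℝ) / 2) + -(((N - 1 : ℕ) : ℝ) / 2) * Real.log ε = 0 by ring,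
    Real.exp_zero, mul_one]

lemma integrable_gaussian {N : ℕ} (yp : Euc N) {ε a : ℝ} (hε : 0 < ε) (ha : 0 < a) :
    Integrable fun y => Real.exp (-(((N - 1 : ℕ) : ℝ) / 2) * Real.log ε - a / ε * ‖y - yp‖ ^ 2) := by
  refine not_imp_comm.1 integral_undef ?_
  rw [integral_gaussian_eq yp hε ha]
  positivity

lemma mul_exp_neg_le {a ε q c : ℝ} (hε : 0 < ε) (ha : 0 < a) :
    q * Real.exp (c - 2 * a / ε * q) ≤ ε / a * Real.exp (c - a / ε * q) := by
  have h1 : a / ε * q ≤ Real.exp (a / ε * q) := by linarith [Real.add_one_le_exp (a / ε * q)]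
  have h2 : q ≤ ε / a * Real.exp (a / ε * q) := by
    calc q = ε / a * (a / ε * q) := by field_simp
      _ ≤ _ := by gcongr
  calc q * Real.exp (c - 2 * a / ε * q)
      ≤ ε / a * Real.exp (a / ε * q) * Real.exp (c - 2 * a / ε * q) := by gcongr
    _ = _ := by
      rw [mul_assoc, ← Real.exp_add]
      congr 2
      ring

lemma Scale.exists_lower_const {N : ℕ} (hN : 2 ≤ N) {d M lam ρ : ℝ} (hS : Scale N d M lam ρ) :
    ∃ τ C, 0 < τ ∧ τ ≤ 1 / 3 ∧ τ + lam * τ ≤ ρ ^ 2 ∧ 0 ≤ C ∧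
      ∀ {β : Euc N → ℝ} {γ u : ℝ × Euc N → ℝ}, CoeffBound β M → NonnegSolution β γ u →
      ∀ {ς : ℝ}, (ς = 1 ∨ ς = -1) → ∀ {x₀ : ℝ} {y₀ : Euc N}, x₀ ∈ Icc (0 : ℝ) 1 →
      y₀ ∈ ball 0 1 → d ≤ ς * β y₀ → ∀ y₁ ∈ closedBall y₀ √τ,
      ∫ p in window ς x₀ y₀ τ, u p ≤ C * u (x₀ - ς * τ, y₁) := by
  have hd := hS.d_pos
  have hM := hS.one_le
  have hdM := hS.d_le
  have hlam := hS.four_le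
  have hρ := hS.rho_pos
  set n : ℝ := ((N - 1 : ℕ) : ℝ) with hn
  have hn1 : 1 ≤ n := by rw [hn]; exact_mod_cast (by omega : 1 ≤ N - 1)
  have hρ1 : ρ ≤ 1 / 36 := by
    have h1 := hS.rho_le
    have h2 : M * (36 * ρ) ≤ M * 1 := by linarith
    have := le_of_mul_le_mul_left h2 (by linarith)
    linarith
  set r := ρ / 2 with hr
  have hr0 : 0 < r := by positivity
  obtain ⟨K, hK0, hK⟩ := exists_bound_exp_neg_div n (by linarith) (a := d * r ^ 2 / 32)
    (by positivity)
  set κ := max 2 K with hκ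
  have hκ2 : 2 ≤ κ := le_max_left _ _
  have hκK : ∀ s, 0 < s → Real.exp (-(n / 2) * Real.log s - d * r ^ 2 / 32 / s) ≤ κ := by
    intro s hs
    refine le_trans ?_ ((hK s hs).trans (le_max_right _ _))
    refine le_mul_of_one_le_right (Real.exp_pos _).le ?_
    have : 0 ≤ 1 / s := by positivity
    linarith
  set B := M + M * (4 + lam) / 18 with hB
  have hB0 : 0 ≤ B := by positivity
  set X := 2 * (B + Real.log (2 * κ)) with hX
  have hlogκ : 0 ≤ Real.log (2 * κ) := Real.log_nonneg (by linarith)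
  have hX0 : 0 ≤ X := by positivity
  set τ := min (ρ ^ 2 / (64 * lam)) (Real.exp (-X) / 2) with hτdef
  have hτ : 0 < τ := by positivity
  have hτl : lam * τ ≤ ρ ^ 2 / 64 := by
    have : τ ≤ ρ ^ 2 / (64 * lam) := min_le_left _ _
    calc lam * τ ≤ lam * (ρ ^ 2 / (64 * lam)) := by gcongr
      _ = _ := by field_simp
  have hτ4 : 4 * τ ≤ lam * τ := by gcongr
  have hρsq : ρ ^ 2 ≤ 1 := by
    have : ρ ^ 2 ≤ 1 ^ 2 := by gcongr; linarith
    linarith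
  have hrsq : r ^ 2 = ρ ^ 2 / 4 := by rw [hr]; ring
  have hκτ : 2 * κ ≤ Real.exp (-(n / 2) * Real.log (2 * τ) - B) := by
    rw [← Real.log_le_iff_le_exp (by linarith)]
    have h1 : Real.log (2 * τ) ≤ -X := by
      rw [Real.log_le_iff_le_exp (by linarith)]
      have : τ ≤ Real.exp (-X) / 2 := min_le_right _ _
      linarith
    have h2 : 1 / 2 * X ≤ n / 2 * -Real.log (2 * τ) :=
      mul_le_mul (by linarith) (by linarith) hX0 (by linarith)
    linarith
  have hsqτ : √τ ≤ ρ := by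
    rw [Real.sqrt_le_iff]
    exact ⟨hρ.le, by linarith [sq_nonneg ρ]⟩
  obtain ⟨θ, hθ⟩ := exists_isCutoff (by linarith : 2 * τ < 3 * τ)
  obtain ⟨Z, hZ⟩ := exists_isCutoff (by linarith [pow_pos hr0 2] : r ^ 2 / 4 < r ^ 2)
  obtain ⟨f, hf⟩ := exists_isTruncation (by linarith : 0 ≤ κ)
  set c := (Real.pi / (d / 32)) ^ (n / 2) with hc
  have hc0 : 0 < c := by positivity
  refine ⟨τ, M * c, hτ, by linarith, by linarith, by positivity, ?_⟩
  intro β γ u hβ hu ς hς x₀ y₀ hx₀ hy₀ hb y₁ hy₁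
  have hW := window_subset_cylD hς hx₀ hy₀ (by linarith : τ ≤ 1)
  have hnorm : ‖y₁ - y₀‖ ≤ √τ := by rwa [mem_closedBall, dist_eq_norm] at hy₁
  have hy₁2 : y₁ ∈ ball (0 : Euc N) 2 := by
    rw [mem_ball_zero_iff] at hy₀ ⊢
    calc ‖y₁‖ = ‖y₁ - y₀ + y₀‖ := by simp
      _ ≤ ‖y₁ - y₀‖ + ‖y₀‖ := norm_add_le _ _
      _ < 2 := by linarith
  have habs : |ς| = 1 := by rcases hς with h | h <;> rw [h] <;> norm_num
  have hς2 : ς * ς = 1 := by rcases hς with h | h <;> rw [h] <;> norm_num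
  have hb₁ : d / 2 ≤ ς * β y₁ := by
    have h1 := hβ.lip y₁ (ball_subset_ball (by norm_num) hy₁2) y₀
      (ball_subset_ball (by norm_num) hy₀)
    have h2 : M * ‖y₁ - y₀‖ ≤ M * ρ := by gcongr; linarith
    have h3 : |ς * β y₁ - ς * β y₀| ≤ M * ρ := by
      rw [← mul_sub, abs_mul, habs, one_mul]; linarith
    linarith [(abs_le.1 h3).1, hS.rho_le]
  set x₁ := x₀ - ς * τ with hx₁
  have hx₁m : x₁ ∈ Icc (-1 : ℝ) 2 := by
    obtain ⟨h1, h2⟩ := hx₀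
    rcases hς with h | h <;> rw [hx₁, h] <;> constructor <;> linarith
  have hbox : Icc (x₁ - 3 * τ) (x₁ + 3 * τ) ×ˢ closedBall y₁ r ⊆ cylD N :=
    Icc_prod_closedBall_subset_cylD hx₁m hy₁2 (by linarith) (by linarith)
  have hp₁ : (x₁, y₁) ∈ cylD N :=
    hbox ⟨⟨by linarith, by linarith⟩, mem_closedBall_self hr0.le⟩
  have hWp : ∀ p ∈ window ς x₀ y₀ τ,
      ς * (p.1 - x₁) ∈ Icc τ (2 * τ) ∧ ‖p.2 - y₁‖ ^ 2 ≤ 4 * τ := by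
    rintro p ⟨⟨h1, h2⟩, h3⟩
    have h4 : ς * (p.1 - x₁) = ς * (p.1 - x₀) + τ := by rw [hx₁]; linear_combination τ * hς2
    refine ⟨by rw [h4]; constructor <;> linarith, ?_⟩
    have h5 : ‖p.2 - y₀‖ ≤ √τ := Real.le_sqrt_of_sq_le h3
    have h6 : ‖p.2 - y₁‖ ≤ 2 * √τ := by
      calc ‖p.2 - y₁‖ = ‖(p.2 - y₀) - (y₁ - y₀)‖ := by congr 1; abel
        _ ≤ ‖p.2 - y₀‖ + ‖y₁ - y₀‖ := norm_sub_le _ _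
        _ ≤ _ := by linarith
    calc ‖p.2 - y₁‖ ^ 2 ≤ (2 * √τ) ^ 2 := by gcongr
      _ = 4 * τ := by rw [mul_pow, Real.sq_sqrt hτ.le]; norm_num
  suffices h : ∀ η > 0, ∫ p in window ς x₀ y₀ τ, u p ≤ M * c * (u (x₁, y₁) + 2 * η) by
    refine le_of_forall_pos_le_add fun η hη => ?_
    have := h (η / (2 * (M * c))) (by positivity)
    have e : M * c * (u (x₁, y₁) + 2 * (η / (2 * (M * c)))) = M * c * u (x₁, y₁) + η := by
      field_simp
    rwa [e] at this
  intro η hη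
  obtain ⟨δ, hδ, hδu⟩ := Metric.continuousAt_iff.1
    (hu.cont.continuousAt ((isOpen_cylD N).mem_nhds hp₁)) η hη
  obtain ⟨Ku, hKu⟩ := hu.bdd
  have hKu0 : 0 ≤ Ku := (hu.nonneg _ hp₁).trans (hKu _ hp₁)
  obtain ⟨ε, hε, hετ, hε1, hε2⟩ : ∃ ε > 0, 2 * ε ≤ τ ∧ 2 * ε < δ ∧
      Ku / δ ^ 2 * (ε / (d / 32)) ≤ η := by
    have hQ : 0 < Ku / δ ^ 2 / (d / 32) + 1 := by positivity
    refine ⟨min (τ / 2) (min (δ / 4) (η / (Ku / δ ^ 2 / (d / 32) + 1))), by positivity, ?_, ?_, ?_⟩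
    · linarith [min_le_left (τ / 2) (min (δ / 4) (η / (Ku / δ ^ 2 / (d / 32) + 1)))]
    · have : min (τ / 2) (min (δ / 4) (η / (Ku / δ ^ 2 / (d / 32) + 1))) ≤ δ / 4 :=
        (min_le_right _ _).trans (min_le_left _ _)
      linarith
    · have h1 : min (τ / 2) (min (δ / 4) (η / (Ku / δ ^ 2 / (d / 32) + 1)))
          ≤ η / (Ku / δ ^ 2 / (d / 32) + 1) := (min_le_right _ _).trans (min_le_right _ _)
      rw [le_div_iff₀ hQ] at h1
      set ε := min (τ / 2) (min (δ / 4) (η / (Ku / δ ^ 2 / (d / 32) + 1)))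
      have h2 : 0 ≤ ε := by positivity
      calc Ku / δ ^ 2 * (ε / (d / 32)) = ε * (Ku / δ ^ 2 / (d / 32)) := by ring
        _ ≤ η := by linarith
  obtain ⟨χ, hχ⟩ := exists_isCutoff (by linarith : ε < 2 * ε)
  have hT : ContDiff ℝ (⊤ : ℕ∞) fun s => (1 - χ s) * θ s :=
    (contDiff_const.sub hχ.contDiff).mul hθ.contDiff
  have hT0 : ∀ s ≤ ε, (1 - χ s) * θ s = 0 := fun s hs => by rw [hχ.eq_one s hs]; ring
  have hsupp : tsupport (kerTest ς x₁ y₁ (ς * β y₁) lam (1 * M) (fun s => (1 - χ s) * θ s) Z f)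
      ⊆ Icc (x₁ - 3 * τ) (x₁ + 3 * τ) ×ˢ closedBall y₁ r :=
    tsupport_kerTest_subset hς hr0 (fun s hs => hT0 s (by linarith))
      (fun s hs => by rw [hθ.eq_zero s hs, mul_zero]) fun q hq => hZ.eq_zero q hq
  set g : ℝ → Euc N → ℝ := fun a y => Real.exp (-(n / 2) * Real.log ε - a / ε * ‖y - y₁‖ ^ 2)
    with hg
  have hgint : ∀ a > 0, Integrable fun p : ℝ × Euc N =>
      M * (-deriv χ (ς * (p.1 - x₁)) * g a p.2) := fun a ha =>
    Integrable.const_mul ((hχ.integrable_neg_deriv_comp hς x₁).mul_prod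
      (integrable_gaussian y₁ hε ha)) M
  obtain ⟨K', hK'0, hK'⟩ := hχ.exists_bound
  have hg0 : ∀ a y, 0 < g a y := fun a y => Real.exp_pos _
  have hgb : ∀ a > 0, ∀ y, g a y ≤ Real.exp (-(n / 2) * Real.log ε) := fun a ha y => by
    refine Real.exp_le_exp.2 ?_
    have : 0 ≤ a / ε * ‖y - y₁‖ ^ 2 := by positivity
    linarith
  have hχ' : ∀ s, 0 ≤ -deriv χ s := fun s => neg_nonneg.2 (hχ.deriv_nonpos s)
  have hAu : ∀ a > 0, IntegrableOn (fun p => u p * (M * (-deriv χ (ς * (p.1 - x₁)) * g a p.2)))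
      (cylD N) := by
    intro a ha
    refine hu.integrableOn_mul (C := M * (K' * Real.exp (-(n / 2) * Real.log ε)))
      (hgint a ha).aestronglyMeasurable.restrict (.of_forall fun p => ?_)
    rw [abs_mul, abs_mul, abs_neg, abs_of_pos (by linarith : 0 < M), abs_of_pos (hg0 _ _)]
    have := (hK' (ς * (p.1 - x₁))).1
    have := hgb a ha p.2
    have := (hg0 a p.2).le
    gcongr
  have key := hu.integral_le_of_adj_le hβ (σ := -1) (.inr rfl)
    (contDiff_kerTest (by linarith) hT hZ.contDiff hf.contDiff hε hT0)
    (HasCompactSupport.of_support_subset_isCompact (isCompact_Icc.prod (isCompact_closedBall _ _))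
      ((subset_tsupport _).trans hsupp)) (hsupp.trans hbox)
    (A := fun p => M * (-deriv χ (ς * (p.1 - x₁)) * g (2 * (d / 32)) p.2))
    (D := (window ς x₀ y₀ τ).indicator fun _ => 1) ?_ (hAu _ (by positivity)) ?_ ?_
  · rw [setIntegral_mul_indicator_const 1 (measurableSet_window _ _ _ _) hW, one_mul] at key
    refine key.trans ?_
    have hval : ∫ p : ℝ × Euc N, M * (-deriv χ (ς * (p.1 - x₁)) * g (d / 32) p.2) = M * c := by
      rw [integral_const_mul, Measure.volume_eq_prod,
        integral_prod_mul (fun x => -deriv χ (ς * (x - x₁))) (g (d / 32)),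
        hχ.integral_neg_deriv_comp hς, one_mul, integral_gaussian_eq y₁ hε (by positivity)]
    have hu₁ := hu.nonneg _ hp₁
    calc _ ≤ ∫ p in cylD N, M * (-deriv χ (ς * (p.1 - x₁)) * g (d / 32) p.2)
          * (u (x₁, y₁) + 2 * η) := by
          refine setIntegral_mono_on (hAu _ (by positivity))
            ((hgint _ (by positivity)).integrableOn.mul_const _) (isOpen_cylD N).measurableSet
            fun p hp => ?_
          have hmain : -deriv χ (ς * (p.1 - x₁)) = 0 ∨ u p * g (2 * (d / 32)) p.2
              ≤ g (d / 32) p.2 * (u (x₁, y₁) + 2 * η) := by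
            by_cases hsε : ς * (p.1 - x₁) < ε ∨ 2 * ε < ς * (p.1 - x₁)
            · left; rw [hχ.deriv_eq_zero hsε, neg_zero]
            right
            push Not at hsε
            have h4 : |p.1 - x₁| ≤ 2 * ε := by
              rcases hς with h | h <;> rw [h] at hsε <;> rw [abs_le] <;> constructor <;> linarith
            have h5 : u p ≤ u (x₁, y₁) + η + Ku / δ ^ 2 * ‖p.2 - y₁‖ ^ 2 := by
              rcases lt_or_ge ‖p.2 - y₁‖ δ with h6 | h6
              · have : dist p (x₁, y₁) < δ := by
                  rw [Prod.dist_eq, max_lt_iff, Real.dist_eq, dist_eq_norm]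
                  exact ⟨by linarith, h6⟩
                have := (abs_lt.1 (hδu this)).2
                have : 0 ≤ Ku / δ ^ 2 * ‖p.2 - y₁‖ ^ 2 := by positivity
                linarith
              · have h7 : Ku ≤ Ku / δ ^ 2 * ‖p.2 - y₁‖ ^ 2 := by
                  calc Ku = Ku / δ ^ 2 * δ ^ 2 := by field_simp
                    _ ≤ _ := by gcongr
                linarith [hKu p hp]
            have h6 := mul_exp_neg_le (q := ‖p.2 - y₁‖ ^ 2) (c := -(n / 2) * Real.log ε) hε
              (by positivity : 0 < d / 32)
            have h7 : g (2 * (d / 32)) p.2 ≤ g (d / 32) p.2 := by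
              refine Real.exp_le_exp.2 ?_
              gcongr
              linarith
            calc u p * g (2 * (d / 32)) p.2
                ≤ (u (x₁, y₁) + η + Ku / δ ^ 2 * ‖p.2 - y₁‖ ^ 2) * g (2 * (d / 32)) p.2 :=
                  mul_le_mul_of_nonneg_right h5 (hg0 _ _).le
              _ = (u (x₁, y₁) + η) * g (2 * (d / 32)) p.2
                  + Ku / δ ^ 2 * (‖p.2 - y₁‖ ^ 2 * g (2 * (d / 32)) p.2) := by ring
              _ ≤ (u (x₁, y₁) + η) * g (d / 32) p.2
                  + Ku / δ ^ 2 * (ε / (d / 32) * g (d / 32) p.2) := by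
                  gcongr
              _ = (u (x₁, y₁) + η) * g (d / 32) p.2
                  + Ku / δ ^ 2 * (ε / (d / 32)) * g (d / 32) p.2 := by ring
              _ ≤ (u (x₁, y₁) + η) * g (d / 32) p.2 + η * g (d / 32) p.2 := by
                  have := hg0 (d / 32) p.2
                  gcongr
              _ = _ := by ring
          rcases hmain with h | h
          · rw [h]; simp
          · have h8 : 0 ≤ M * -deriv χ (ς * (p.1 - x₁)) :=
              mul_nonneg (by linarith) (hχ' _)
            have := mul_le_mul_of_nonneg_left h h8
            linarith
      _ ≤ ∫ p : ℝ × Euc N, M * (-deriv χ (ς * (p.1 - x₁)) * g (d / 32) p.2)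
          * (u (x₁, y₁) + 2 * η) := by
          refine setIntegral_le_integral ((hgint _ (by positivity)).mul_const _)
            (.of_forall fun p => ?_)
          exact mul_nonneg (mul_nonneg (by linarith) (mul_nonneg (hχ' _) (hg0 _ _).le))
            (by linarith)
      _ = _ := by rw [integral_mul_const, hval]
  · intro p
    refine mul_nonneg (mul_nonneg (mul_nonneg ?_ (hθ.nonneg _)) (hZ.nonneg _)) (hf.nonneg _)
    linarith [hχ.le_one (ς * (p.1 - x₁))]
  · refine hu.integrableOn_mul (C := 1) ?_ (.of_forall fun p => ?_)
    · exact (measurable_const.indicator (measurableSet_window _ _ _ _)).aestronglyMeasurable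
    · rw [abs_of_nonneg (indicator_nonneg (fun _ _ => zero_le_one) _)]
      exact indicator_le_self' (fun _ _ => zero_le_one) _
  · intro p hp
    have := hS.adj_lower_bound (by linarith) (by linarith) (by linarith) hκ2 hκK hκτ hθ hZ hf hβ hς
      hy₁2 hb₁ hε hετ hχ hWp hp
    refine this.trans (le_of_eq ?_)
    have e : d / (16 * ε) = 2 * (d / 32) / ε := by field_simp; norm_num
    simp only [hg, e, ← hn]

lemma exists_coeffBound {N : ℕ} {β : Euc N → ℝ}
    (hβsmooth : ContDiffOn ℝ (⊤ : ℕ∞) β (ball (0 : Euc N) 3))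
    (hβbdd : ∀ k : ℕ, ∃ M : ℝ, ∀ y ∈ ball (0 : Euc N) 3,
      ‖iteratedFDerivWithin ℝ k β (ball (0 : Euc N) 3) y‖ ≤ M) :
    ∃ M, CoeffBound β M := by
  obtain ⟨M₀, h₀⟩ := hβbdd 0
  obtain ⟨M₁, h₁⟩ := hβbdd 1
  refine ⟨max 1 (max M₀ M₁), le_max_left _ _, fun y hy => ?_, fun y hy z hz => ?_⟩
  · have := h₀ y hy
    rw [norm_iteratedFDerivWithin_zero, Real.norm_eq_abs] at this
    exact this.trans ((le_max_left _ _).trans (le_max_right _ _))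
  · rw [← Real.norm_eq_abs]
    refine (convex_ball (0 : Euc N) 3).norm_image_sub_le_of_norm_fderivWithin_le (𝕜 := ℝ)
      (hβsmooth.differentiableOn (by simp)) (fun w hw => ?_) hz hy
    have := h₁ w hw
    rw [norm_iteratedFDerivWithin_one _ (isOpen_ball.uniqueDiffWithinAt hw)] at this
    exact this.trans ((le_max_right _ _).trans (le_max_right _ _))

lemma norm_le_add_of_mem_closedBall {N : ℕ} {y z : Euc N} {r : ℝ} (h : y ∈ closedBall z r) :
    ‖y‖ ≤ r + ‖z‖ := by
  rw [mem_closedBall, dist_eq_norm] at h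
  calc ‖y‖ = ‖y - z + z‖ := by simp
    _ ≤ ‖y - z‖ + ‖z‖ := norm_add_le _ _
    _ ≤ _ := by linarith

lemma CoeffBound.half_le {N : ℕ} {β : Euc N → ℝ} {M d r ς : ℝ} (hβ : CoeffBound β M)
    (hς : ς = 1 ∨ ς = -1) {y z : Euc N} (hz : z ∈ ball 0 1) (hr : r ≤ 1) (hMr : M * r ≤ d / 2)
    (hd : d ≤ ς * β z) (hy : y ∈ closedBall z r) : d / 2 ≤ ς * β y := by
  have hM := hβ.one_le
  have hy3 : y ∈ ball (0 : Euc N) 3 := by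
    rw [mem_ball_zero_iff] at hz ⊢
    linarith [norm_le_add_of_mem_closedBall hy]
  have h1 := hβ.lip y hy3 z (ball_subset_ball (by norm_num) hz)
  rw [mem_closedBall, dist_eq_norm] at hy
  have h2 : M * ‖y - z‖ ≤ M * r := by gcongr
  have h3 : |β y - β z| ≤ d / 2 := by linarith
  have h4 := abs_le.1 h3
  rcases hς with rfl | rfl <;> linarith

lemma exists_harnack_const_of_sign {N : ℕ} (hN : 2 ≤ N) {β : Euc N → ℝ} {M d ς : ℝ}
    (hβ : CoeffBound β M) (hd : 0 < d) (hς : ς = 1 ∨ ς = -1) {z : Euc N} (hz : z ∈ ball 0 1)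
    (hdz : d ≤ -ς * β z) :
    ∃ C, 0 ≤ C ∧ ∀ {γ u : ℝ × Euc N → ℝ}, NonnegSolution β γ u →
      ∀ x₀ ∈ Icc (0 : ℝ) 1, ∀ y₀ ∈ ball (0 : Euc N) 1, d ≤ ς * β y₀ →
      ∀ x ∈ Icc (0 : ℝ) 1, ∀ y ∈ ball (0 : Euc N) 1, u (x₀, y₀) ≤ C * u (x, y) := by
  have hM := hβ.one_le
  have hς' : -ς = 1 ∨ -ς = -1 := by rcases hς with h | h <;> simp [h]
  have hdM : d ≤ M := by
    have h1 := abs_le.1 (hβ.abs_bound z (ball_subset_ball (by norm_num) hz))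
    rcases hς with h | h <;> rw [h] at hdz <;> linarith
  set n : ℝ := ((N - 1 : ℕ) : ℝ) with hn
  have hn0 : 0 ≤ n := Nat.cast_nonneg _
  set lam := 4 + 8 * (n / 2 + 3 * n + 4) / d with hlam
  set ρ := d / (36 * M) with hρ
  have hS : Scale N d M lam ρ := by
    refine ⟨hd, hdM, hM, ?_, ?_, by positivity, ?_⟩
    · have : 0 ≤ 8 * (n / 2 + 3 * n + 4) / d := by positivity
      linarith
    · have : d / 2 * lam / 4 = d / 2 + (n / 2 + 3 * n + 4) := by
        rw [hlam]; field_simp; ring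
      rw [this, ← hn]
      linarith
    · rw [hρ]
      exact le_of_eq (by field_simp)
  obtain ⟨τ, C₂, hτ, hτ3, hτρ, hC₂, hlow⟩ := hS.exists_lower_const hN
  obtain ⟨C₁, hC₁, hup⟩ := hS.exists_upper_const hτ (by linarith) hτρ
  have hr₁ : 0 < √τ := Real.sqrt_pos.2 hτ
  have hr₁ρ : √τ ≤ ρ := by
    rw [Real.sqrt_le_iff]
    have : 0 ≤ lam * τ := by have := hS.four_le; positivity
    exact ⟨hS.rho_pos.le, by linarith⟩
  have hr₁1 : √τ ≤ 1 := Real.sqrt_le_one.2 (by linarith)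
  have hMr₁ : M * √τ ≤ d / 2 := by
    have : M * √τ ≤ M * ρ := by gcongr
    linarith [hS.rho_le]
  have hz1 : ‖z‖ < 1 := mem_ball_zero_iff.1 hz
  set r := min √τ ((1 - ‖z‖) / 2) with hr
  have hr0 : 0 < r := lt_min hr₁ (by linarith)
  have hrτ : r ≤ √τ := min_le_left _ _
  have hrz : r ≤ (1 - ‖z‖) / 2 := min_le_right _ _
  have hMr : M * r ≤ d / 2 := le_trans (by gcongr) hMr₁
  set R' := (3 + ‖z‖) / 2 with hR'
  obtain ⟨c₁, hc₁, H₁⟩ := exists_drift_const N (T := 3) hr₁ (half_pos hd)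
  obtain ⟨c₂, hc₂, H₂⟩ := exists_spread_const N (R := 2) (R' := R') (ε := 1 / 2) hM (half_pos hr₁)
    (by positivity) (by linarith) (by norm_num)
  obtain ⟨c₃, hc₃, H₃⟩ := exists_drift_const N (T := 5) hr0 (half_pos hd)
  obtain ⟨c₄, hc₄, H₄⟩ := exists_spread_const N (R := 2) (R' := R') (ε := 1 / 2) hM (half_pos hr0)
    (by positivity) (by linarith) (by norm_num)
  set A := C₁ * C₂ + 1 with hA
  have hA0 : 0 < A := by positivity
  refine ⟨A / (c₄ * (c₃ * (c₂ * c₁))), by positivity, ?_⟩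
  intro γ u hu x₀ hx₀ y₀ hy₀ hb x hx y hy
  have hball : ∀ w ∈ ball (0 : Euc N) 1, ∀ t ≤ 2, closedBall w t ⊆ ball (0 : Euc N) 3 := by
    intro w hw t ht v hv
    rw [mem_ball_zero_iff] at hw ⊢
    linarith [norm_le_add_of_mem_closedBall hv]
  have hy₀1 : ‖y₀‖ < 1 := mem_ball_zero_iff.1 hy₀
  set x₁ := x₀ - ς * τ with hx₁
  set m := u (x₀, y₀) / A with hm
  have hp₀ : (x₀, y₀) ∈ cylD N :=
    ⟨⟨by linarith [hx₀.1], by linarith [hx₀.2]⟩, ball_subset_ball (by norm_num) hy₀⟩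
  have hm0 : 0 ≤ m := div_nonneg (hu.nonneg _ hp₀) hA0.le
  have hx₁b : x₁ ∈ Icc (-1 / 3 : ℝ) (4 / 3) ∧ ς * x₁ ≤ ς * (1 / 2) + 1 / 2 := by
    obtain ⟨h1, h2⟩ := hx₀
    rcases hς with h | h <;> rw [hx₁, h] <;> refine ⟨⟨?_, ?_⟩, ?_⟩ <;> linarith
  obtain ⟨⟨hxl, hxu⟩, hxς⟩ := hx₁b
  have s₀ : ∀ w ∈ closedBall y₀ √τ, m ≤ u (x₁, w) := by
    intro w hw
    have hw0 : 0 ≤ u (x₁, w) := hu.nonneg _ ⟨⟨by dsimp only; linarith, by dsimp only; linarith⟩,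
      hball y₀ hy₀ _ (by linarith) hw⟩
    rw [hm, div_le_iff₀ hA0]
    have h1 := hup hβ hu hς hx₀ hy₀ hb
    have h2 := mul_le_mul_of_nonneg_left (hlow hβ hu hς hx₀ hy₀ hb w hw) hC₁
    linarith
  have s₁ := H₁ hβ hu hς hm0 (hball y₀ hy₀ _ (by linarith))
    (fun w hw => hβ.half_le hς hy₀ hr₁1 hMr₁ hb hw) (xa := x₁) ⟨by linarith, by linarith⟩
    (by rcases hς with h | h <;> rw [h] <;> constructor <;> linarith) s₀
  set xa := x₁ - ς * (3 / 2) with hxa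
  have hς2 : ς * ς = 1 := by rcases hς with h | h <;> rw [h] <;> norm_num
  have s₂ := H₂ hβ hu (mul_nonneg hc₁.le hm0) (hball y₀ hy₀ _ le_rfl) (xc := xa)
    (fun t ht => by
      obtain ⟨h1, h2⟩ := ht
      rcases hς with h | h <;> rw [hxa, h] at h1 h2 <;> constructor <;> linarith)
    (fun t ht => by
      obtain ⟨h1, h2⟩ := ht
      refine s₁ t ?_ ?_ <;>
      · rcases hς with h | h <;> rw [hxa, h] at h1 h2 <;> rw [h] <;> linarith)
  have s₃ := H₃ hβ hu hς' (yc := z) (xa := xa)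
    (mul_nonneg hc₂.le (mul_nonneg hc₁.le hm0)) (hball z hz _ (by linarith))
    (fun w hw => hβ.half_le hς' hz (by linarith) hMr hdz hw)
    (by rcases hς with h | h <;> rw [hxa, h] <;> constructor <;> linarith)
    (by rcases hς with h | h <;> rw [hxa, h] <;> constructor <;> linarith)
    (fun w hw => s₂ w (by
      have h1 := norm_le_add_of_mem_closedBall hw
      have h2 := norm_sub_le w y₀
      rw [mem_closedBall, dist_eq_norm]
      linarith))
  have s₄ := H₄ hβ hu (yc := z) (xc := x)
    (mul_nonneg hc₃.le (mul_nonneg hc₂.le (mul_nonneg hc₁.le hm0))) (hball z hz _ le_rfl)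
    (fun t ht => ⟨by linarith [ht.1, hx.1], by linarith [ht.2, hx.2]⟩)
    (fun t ht => by
      obtain ⟨h1, h2⟩ := ht
      obtain ⟨h3, h4⟩ := hx
      refine s₃ t ?_ ?_ <;>
      · rcases hς with h | h <;> rw [h] at hxς <;> rw [hxa, h] <;> linarith)
    y (by
      have h1 := mem_ball_zero_iff.1 hy
      have h2 := norm_sub_le y z
      rw [mem_closedBall, dist_eq_norm]
      linarith)
  rw [div_mul_eq_mul_div, le_div_iff₀ (by positivity)]
  calc u (x₀, y₀) * (c₄ * (c₃ * (c₂ * c₁))) = A * (c₄ * (c₃ * (c₂ * (c₁ * m)))) := by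
        rw [hm]; field_simp
    _ ≤ A * u (x, y) := by gcongr

/-- In the normalized setting, for every `d > 0` with `A_d^+` and `A_d^−` nonempty there is
`C ≥ 1`, depending only on `N`, `d` and `β` (not on `γ` or `u`), with
`sup_{[0,1]×A_d} u ≤ C · inf_{[0,1]×B_1(0)} u`. -/
theorem sup_on_Ad_le_inf
    (N : ℕ) (hN : 2 ≤ N)
    (β : Euc N → ℝ) (hβsmooth : ContDiffOn ℝ (⊤ : ℕ∞) β (ball (0 : Euc N) 3))
    (hβbdd : ∀ k : ℕ, ∃ M : ℝ, ∀ y ∈ ball (0 : Euc N) 3,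
      ‖iteratedFDerivWithin ℝ k β (ball (0 : Euc N) 3) y‖ ≤ M)
    (hβneg : ∃ y ∈ ball (0 : Euc N) 1, β y < 0)
    (hβpos : ∃ y ∈ ball (0 : Euc N) 1, 0 < β y)
    (d : ℝ) (hd : 0 < d) (hAp : (Aplus β d).Nonempty) (hAm : (Aminus β d).Nonempty) :
    ∃ C ≥ (1 : ℝ),
      ∀ γ : ℝ × Euc N → ℝ, Measurable γ →
        (∀ᵐ p ∂(volume.restrict (cylD N)), |γ p| ≤ 1) →
      ∀ u : ℝ × Euc N → ℝ, ContinuousOn u (cylD N) →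
        (∀ p ∈ cylD N, 0 ≤ u p) →
        (∃ K : ℝ, ∀ p ∈ cylD N, u p ≤ K) →
        IsDistribSolution (cylD N) β γ u →
        sSup (u '' (Icc (0 : ℝ) 1 ×ˢ (Aplus β d ∪ Aminus β d)))
          ≤ C * sInf (u '' (Icc (0 : ℝ) 1 ×ˢ ball (0 : Euc N) 1)) := by
  obtain ⟨M, hM⟩ := exists_coeffBound hβsmooth hβbdd
  obtain ⟨zp, hzp, hzp'⟩ := hAp
  obtain ⟨zm, hzm, hzm'⟩ := hAm
  obtain ⟨C₁, hC₁, H₁⟩ := exists_harnack_const_of_sign hN hM hd (ς := 1) (.inl rfl) hzm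
    (by linarith)
  obtain ⟨C₂, hC₂, H₂⟩ := exists_harnack_const_of_sign hN hM hd (ς := -1) (.inr rfl) hzp
    (by linarith)
  have hC : 0 < max 1 (max C₁ C₂) := lt_max_of_lt_left one_pos
  refine ⟨max 1 (max C₁ C₂), le_max_left _ _, fun γ hγ hγ1 u huc hu0 hub hus => ?_⟩
  have hu : NonnegSolution β γ u := ⟨hγ, hγ1, huc, hu0, hub, hus⟩
  have h0 : (0 : ℝ) ∈ Icc (0 : ℝ) 1 := ⟨le_rfl, zero_le_one⟩
  refine csSup_le (Nonempty.image u ⟨(0, zp), h0, .inl ⟨hzp, hzp'⟩⟩) ?_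
  rintro _ ⟨⟨x₀, y₀⟩, ⟨hx₀, hy₀⟩, rfl⟩
  rw [← div_le_iff₀' hC]
  refine le_csInf (Nonempty.image u ⟨(0, zp), h0, hzp⟩) ?_
  rintro _ ⟨⟨x, y⟩, ⟨hx, hy⟩, rfl⟩
  rw [div_le_iff₀' hC]
  have hxy : 0 ≤ u (x, y) :=
    hu0 _ ⟨⟨by linarith [hx.1], by linarith [hx.2]⟩, ball_subset_ball (by norm_num) hy⟩
  rcases hy₀ with ⟨hy₀, hb⟩ | ⟨hy₀, hb⟩
  · refine (H₁ hu x₀ hx₀ y₀ hy₀ (by linarith) x hx y hy).trans ?_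
    gcongr
    exact (le_max_left _ _).trans (le_max_right _ _)
  · refine (H₂ hu x₀ hx₀ y₀ hy₀ (by linarith) x hx y hy).trans ?_
    gcongr
    exact (le_max_right _ _).trans (le_max_right _ _)
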